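/- arXiv:1606.02521 — 4 statements merged into one kernel-verified Lean document; each statement's English description precedes it below -/
import Mathlib

section
/- Let k be an algebraically closed field of characteristic 0, q ∈ k^× and G ∈ ℕ with G ≥ 1. In the free algebra k⟨x_1,x_2,x_3⟩ define z_0 := x_3 and z_{t+1} := x_2·z_t − q·z_t·x_2 for t ≥ 0. Let A be the quotient of k⟨x_1,x_2,x_3⟩ by the two-sided ideal generated by: x_2x_1 − x_1x_2 + (1/2)x_1², x_1x_3 − q·x_3x_1, z_{G+1}, and z_t·z_{t+1} − q^{−1}·z_{t+1}·z_t for 0 ≤ t < G. Then the images of the monomials x_1^{m_1}·x_2^{m_2}·z_G^{n_G}·z_{G−1}^{n_{G−1}}·⋯·z_1^{n_1}·z_0^{n_0}, with m_1, m_2, n_0, …, n_G ∈ ℕ, form a k-basis of A, and GKdim A = G + 3. (A is the Nichols algebra B(lstr(1,G)) of the braided vector space consisting of a Jordan block, a point with label 1, weak interaction and discrete ghost G.) -/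
open scoped ENNReal

/-- The Gelfand–Kirillov dimension of a `k`-algebra `A`. -/
noncomputable def GKdim (k A : Type*) [Field k] [Ring A] [Algebra k A] : ℝ≥0∞ :=
  ⨆ (V : Submodule k A) (_ : FiniteDimensional k V),
    Filter.limsup
      (fun n : ℕ =>
        ENNReal.ofReal
          (Real.log ((Module.finrank k (↥(∑ j ∈ Finset.range (n + 1), V ^ j)) : ℕ) : ℝ) /
            Real.log (n : ℝ)))
      Filter.atTop

/-- The generator `x_{i+1}` of the free algebra `k⟨x₁,x₂,x₃⟩`. -/
noncomputable def X (k : Type*) [Field k] (i : Fin 3) : FreeAlgebra k (Fin 3) :=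
  FreeAlgebra.ι k i

/-- `z₀ := x₃`, `z_{t+1} := x₂ z_t − q z_t x₂`. -/
noncomputable def z (k : Type*) [Field k] (q : k) : ℕ → FreeAlgebra k (Fin 3)
  | 0 => X k 2
  | (t + 1) => X k 1 * z k q t - q • (z k q t * X k 1)

/-- The defining relations of `B(lstr(1,G))`. -/
def lstrRel (k : Type*) [Field k] (q : k) (G : ℕ)
    (a b : FreeAlgebra k (Fin 3)) : Prop :=
  b = 0 ∧
    (a = X k 1 * X k 0 - X k 0 * X k 1 + ((2 : k)⁻¹) • (X k 0 * X k 0) ∨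
     a = X k 0 * X k 2 - q • (X k 2 * X k 0) ∨
     a = z k q (G + 1) ∨
     ∃ t < G, a = z k q t * z k q (t + 1) - q⁻¹ • (z k q (t + 1) * z k q t))

/-- The PBW monomials `x₁^{m₁} x₂^{m₂} z_G^{n_G} ⋯ z₁^{n₁} z₀^{n₀}` in `B(lstr(1,G))`. -/
noncomputable def bas (k : Type*) [Field k] (q : k) (G : ℕ)
    (p : ℕ × ℕ × (Fin (G + 1) → ℕ)) : RingQuot (lstrRel k q G) :=
  RingQuot.mkAlgHom k (lstrRel k q G)
    (X k 0 ^ p.1 * X k 1 ^ p.2.1 *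
      ((List.ofFn fun t : Fin (G + 1) => z k q (t : ℕ) ^ p.2.2 t).reverse).prod)

/-- Elements of a `k`-algebra subject to the defining relations of `B(lstr(1,G))`. -/
structure LstrGens (k : Type*) [Field k] (q : k) (G : ℕ) (A : Type*) [Ring A] [Algebra k A] where
  x : A
  y : A
  w : ℕ → A
  jordan : y * x = x * y - (2 : k)⁻¹ • (x * x)
  weak : x * w 0 = q • (w 0 * x)
  w_succ : ∀ t, w (t + 1) = y * w t - q • (w t * y)
  ghost : w (G + 1) = 0
  qcomm_succ : ∀ t < G, w t * w (t + 1) = q⁻¹ • (w (t + 1) * w t)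

namespace LstrGens

variable {k : Type*} [Field k] {q : k} {G : ℕ} {A : Type*} [Ring A] [Algebra k A]
  (g : LstrGens k q G A)

theorem w_eq_zero {t : ℕ} (ht : G < t) : g.w t = 0 := by
  induction t, ht using Nat.le_induction with
  | base => exact g.ghost
  | succ t _ ih => simp [g.w_succ, ih]

theorem y_mul_w (t : ℕ) : g.y * g.w t = g.w (t + 1) + q • (g.w t * g.y) := by
  rw [g.w_succ]; abel

theorem x_mul_w (t : ℕ) : g.x * g.w t = q • (g.w t * g.x) := by
  induction t with
  | zero => exact g.weak
  | succ t ih =>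
    have hxy : g.x * g.y = g.y * g.x + (2 : k)⁻¹ • (g.x * g.x) := by rw [g.jordan]; abel
    have h1 : g.x * (g.y * g.w t) =
        q • (g.y * g.w t * g.x) + (2 : k)⁻¹ • (q • q • (g.w t * g.x * g.x)) := by
      rw [← mul_assoc, hxy, add_mul, mul_assoc, ih, smul_mul_assoc, mul_assoc, ih,
        mul_smul_comm, mul_smul_comm, ← mul_assoc g.x, ih]
      simp only [smul_mul_assoc, mul_assoc]
    have h2 : g.x * (g.w t * g.y) =
        q • (g.w t * g.y * g.x) + (2 : k)⁻¹ • (q • (g.w t * g.x * g.x)) := by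
      rw [← mul_assoc, ih, smul_mul_assoc, mul_assoc, hxy, mul_add, smul_add, mul_smul_comm,
        smul_comm q]
      simp only [mul_assoc]
    rw [g.w_succ, mul_sub, mul_smul_comm, h1, h2, sub_mul, smul_mul_assoc]
    simp only [smul_add, smul_sub]
    rw [smul_comm q (2 : k)⁻¹]
    abel

theorem w_mul_w_add (hq : q ≠ 0) (d : ℕ) :
    ∀ s, g.w s * g.w (s + d) = (q⁻¹) ^ d • (g.w (s + d) * g.w s) := by
  induction d using Nat.strong_induction_on with
  | _ d ih =>
    match d, ih with
    | 0, _ => simp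
    | 1, _ =>
      intro s
      rcases lt_or_ge s G with h | h
      · simpa using g.qcomm_succ s h
      · simp [g.w_eq_zero (show G < s + 1 by omega)]
    | d + 2, ih =>
      intro s
      have h0 := ih d (by omega) (s + 1)
      have h1 := ih (d + 1) (by omega) s
      rw [show s + 1 + d = s + (d + 1) by ring] at h0
      have e := g.w_succ (s + (d + 1))
      rw [show s + (d + 1) + 1 = s + (d + 2) by ring] at e
      set a := g.w s
      set b := g.w (s + (d + 1))
      have hL : g.y * (a * b) - q • q • (a * b * g.y) =
          g.w (s + 1) * b + q • (a * g.w (s + (d + 2))) := by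
        rw [e, g.w_succ s]
        simp only [sub_mul, mul_sub, smul_mul_assoc, mul_smul_comm, smul_sub, mul_assoc]
        abel
      have hR : g.y * (b * a) - q • q • (b * a * g.y) =
          g.w (s + (d + 2)) * a + q • (b * g.w (s + 1)) := by
        rw [e, g.w_succ s]
        simp only [sub_mul, mul_sub, smul_mul_assoc, mul_smul_comm, smul_sub, mul_assoc]
        abel
      rw [h1, smul_mul_assoc, mul_smul_comm, smul_comm q ((q⁻¹) ^ (d + 1)),
        smul_comm q ((q⁻¹) ^ (d + 1)), ← smul_sub, hR, h0] at hL
      have hs : (q⁻¹) ^ (d + 1) • q • (b * g.w (s + 1)) = (q⁻¹) ^ d • (b * g.w (s + 1)) := by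
        rw [smul_smul, pow_succ, mul_assoc, inv_mul_cancel₀ hq, mul_one]
      rw [smul_add, hs, add_comm, add_left_cancel_iff] at hL
      rw [pow_succ', mul_smul, hL, smul_smul, inv_mul_cancel₀ hq, one_smul]

/-- Any two of the elements `w t` commute up to a scalar. -/
theorem exists_w_mul_w (hq : q ≠ 0) (s t : ℕ) :
    ∃ c : k, g.w s * g.w t = c • (g.w t * g.w s) := by
  rcases le_total s t with h | h
  · obtain ⟨d, rfl⟩ := Nat.exists_eq_add_of_le h
    exact ⟨_, g.w_mul_w_add hq d s⟩
  · obtain ⟨d, rfl⟩ := Nat.exists_eq_add_of_le h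
    refine ⟨q ^ d, ?_⟩
    rw [g.w_mul_w_add hq d t, smul_smul, ← mul_pow, mul_inv_cancel₀ hq, one_pow, one_smul]

theorem exists_w_mul_w_pow (hq : q ≠ 0) (s t n : ℕ) :
    ∃ c : k, g.w s * g.w t ^ n = c • (g.w t ^ n * g.w s) := by
  obtain ⟨c, hc⟩ := g.exists_w_mul_w hq s t
  refine ⟨c ^ n, ?_⟩
  induction n with
  | zero => simp
  | succ n ih =>
    rw [pow_succ, ← mul_assoc, ih, smul_mul_assoc, mul_assoc, hc, mul_smul_comm, smul_smul,
      pow_succ, mul_assoc]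

/-- The ordered monomial `w_G ^ n_G ⋯ w_0 ^ n_0`. -/
def wmon (n : Fin (G + 1) → ℕ) : A :=
  ((List.finRange (G + 1)).reverse.map fun t : Fin (G + 1) => g.w t ^ n t).prod

theorem exists_w_mul_list_prod (hq : q ≠ 0) (n : Fin (G + 1) → ℕ) (i : Fin (G + 1))
    (l : List (Fin (G + 1))) (hl : l.Nodup) (hi : i ∈ l) :
    ∃ c : k, g.w i * (l.map fun t : Fin (G + 1) => g.w t ^ n t).prod =
      c • (l.map fun t : Fin (G + 1) => g.w t ^ (n + Pi.single i 1 : Fin (G + 1) → ℕ) t).prod := by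
  induction l with
  | nil => simp at hi
  | cons j l ih =>
    rw [List.nodup_cons] at hl
    simp only [List.map_cons, List.prod_cons]
    by_cases hij : i = j
    · subst hij
      refine ⟨1, ?_⟩
      have : (l.map fun t : Fin (G + 1) => g.w t ^ (n + Pi.single i 1 : Fin (G + 1) → ℕ) t) =
          l.map fun t : Fin (G + 1) => g.w t ^ n t := by
        refine List.map_congr_left fun t ht => ?_
        have : t ≠ i := fun h => hl.1 (h ▸ ht)
        simp [this]
      rw [this, one_smul, ← mul_assoc]
      simp [pow_succ']
    · obtain ⟨c, hc⟩ := ih hl.2 (by simpa [hij] using hi)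
      obtain ⟨c', hc'⟩ := g.exists_w_mul_w_pow hq i j (n j)
      refine ⟨c' * c, ?_⟩
      rw [← mul_assoc, hc', smul_mul_assoc, mul_assoc, hc, mul_smul_comm, smul_smul]
      simp [Ne.symm hij]

theorem exists_w_mul_wmon (hq : q ≠ 0) (n : Fin (G + 1) → ℕ) (i : Fin (G + 1)) :
    ∃ c : k, g.w i * g.wmon n = c • g.wmon (n + Pi.single i 1) :=
  g.exists_w_mul_list_prod hq n i _ (List.nodup_reverse.2 (List.nodup_finRange _)) (by simp)

/-- The ordered monomial `x ^ m₁ * y ^ m₂ * w_G ^ n_G ⋯ w_0 ^ n_0`. -/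
def mon (p : ℕ × ℕ × (Fin (G + 1) → ℕ)) : A := g.x ^ p.1 * g.y ^ p.2.1 * g.wmon p.2.2

/-- The degree of an ordered monomial, where `w_t` has degree `t + 1`. -/
def wt (p : ℕ × ℕ × (Fin (G + 1) → ℕ)) : ℕ :=
  p.1 + p.2.1 + ∑ t : Fin (G + 1), ((t : ℕ) + 1) * p.2.2 t

/-- The span of the ordered monomials of degree at most `m`. -/
def fil (m : ℕ) : Submodule k A := Submodule.span k (g.mon '' {p | wt p ≤ m})

theorem mon_mem_fil {p : ℕ × ℕ × (Fin (G + 1) → ℕ)} {m : ℕ} (h : wt p ≤ m) :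
    g.mon p ∈ g.fil m := Submodule.subset_span ⟨p, h, rfl⟩

theorem fil_mono : Monotone g.fil := fun _ _ h =>
  Submodule.span_mono (Set.image_mono fun _ hp => le_trans hp h)

/-- To bound `a * fil m` it suffices to look at ordered monomials. -/
theorem mul_mem_fil {a : A} {d : ℕ}
    (h : ∀ p : ℕ × ℕ × (Fin (G + 1) → ℕ), a * g.mon p ∈ g.fil (wt p + d)) {m : ℕ} {b : A}
    (hb : b ∈ g.fil m) : a * b ∈ g.fil (m + d) := by
  induction hb using Submodule.span_induction with
  | mem b hb =>
    obtain ⟨p, hp, rfl⟩ := hb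
    exact g.fil_mono (by have : wt p ≤ m := hp; omega) (h p)
  | zero => simp
  | add b c _ _ hb hc => rw [mul_add]; exact add_mem hb hc
  | smul c b _ hb => rw [mul_smul_comm]; exact Submodule.smul_mem _ _ hb

theorem x_mul_mem {m : ℕ} {b : A} (hb : b ∈ g.fil m) : g.x * b ∈ g.fil (m + 1) := by
  refine g.mul_mem_fil (fun p => ?_) hb
  have : g.x * g.mon p = g.mon (p.1 + 1, p.2.1, p.2.2) := by
    simp only [mon, pow_succ', mul_assoc]
  rw [this]
  exact g.mon_mem_fil (by simp only [wt]; omega)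

theorem y_mul_x_pow (a : ℕ) :
    g.y * g.x ^ a = g.x ^ a * g.y - ((a : k) * (2 : k)⁻¹) • g.x ^ (a + 1) := by
  induction a with
  | zero => simp
  | succ a ih =>
    rw [pow_succ, ← mul_assoc, ih, sub_mul, mul_assoc, g.jordan, mul_sub, mul_smul_comm,
      smul_mul_assoc, ← mul_assoc, ← mul_assoc, ← pow_succ, ← pow_succ, sub_sub,
      ← add_smul]
    congr 2
    push_cast
    ring

theorem y_mul_mem {m : ℕ} {b : A} (hb : b ∈ g.fil m) : g.y * b ∈ g.fil (m + 1) := by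
  refine g.mul_mem_fil (fun p => ?_) hb
  have : g.y * g.mon p = g.mon (p.1, p.2.1 + 1, p.2.2) -
      ((p.1 : k) * (2 : k)⁻¹) • g.mon (p.1 + 1, p.2.1, p.2.2) := by
    simp only [mon]
    rw [← mul_assoc, ← mul_assoc, g.y_mul_x_pow]
    simp only [sub_mul, smul_mul_assoc, pow_succ' g.y, mul_assoc]
  rw [this]
  exact sub_mem (g.mon_mem_fil (by simp only [wt]; omega))
    (Submodule.smul_mem _ _ (g.mon_mem_fil (by simp only [wt]; omega)))

theorem x_pow_mul_mem (a : ℕ) {m : ℕ} {b : A} (hb : b ∈ g.fil m) :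
    g.x ^ a * b ∈ g.fil (m + a) := by
  induction a with
  | zero => simpa using hb
  | succ a ih => rw [pow_succ', mul_assoc]; exact g.x_mul_mem ih

theorem y_pow_mul_mem (a : ℕ) {m : ℕ} {b : A} (hb : b ∈ g.fil m) :
    g.y ^ a * b ∈ g.fil (m + a) := by
  induction a with
  | zero => simpa using hb
  | succ a ih => rw [pow_succ', mul_assoc]; exact g.y_mul_mem ih

theorem w_mul_y_pow_mul_wmon_mem (hq : q ≠ 0) (n : Fin (G + 1) → ℕ) (b : ℕ) : ∀ t : ℕ,
    g.w t * (g.y ^ b * g.wmon n) ∈ g.fil (wt (0, b, n) + (t + 1)) := by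
  induction b with
  | zero =>
    intro t
    rcases lt_or_ge G t with h | h
    · simp [g.w_eq_zero h]
    · obtain ⟨c, hc⟩ := g.exists_w_mul_wmon hq n ⟨t, by omega⟩
      rw [pow_zero, one_mul, show g.w t = g.w ((⟨t, by omega⟩ : Fin (G + 1)) : ℕ) from rfl, hc]
      refine Submodule.smul_mem _ _ ?_
      have : g.wmon (n + Pi.single ⟨t, by omega⟩ 1) =
          g.mon (0, 0, n + Pi.single ⟨t, by omega⟩ 1) := by simp [mon]
      rw [this]
      refine g.mon_mem_fil ?_
      simp [wt, mul_add, Finset.sum_add_distrib, Pi.single_apply]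
  | succ b ih =>
    intro t
    have h : g.w t * (g.y ^ (b + 1) * g.wmon n) =
        q⁻¹ • (g.y * (g.w t * (g.y ^ b * g.wmon n)) - g.w (t + 1) * (g.y ^ b * g.wmon n)) := by
      rw [← mul_assoc g.y, g.y_mul_w, add_mul, add_sub_cancel_left, smul_mul_assoc, smul_smul,
        inv_mul_cancel₀ hq, one_smul, pow_succ']
      simp only [mul_assoc]
    rw [h]
    refine Submodule.smul_mem _ _ (sub_mem ?_ ?_)
    · exact g.fil_mono (by simp only [wt]; omega) (g.y_mul_mem (ih t))
    · exact g.fil_mono (by simp only [wt]; omega) (ih (t + 1))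

theorem w_mul_x_pow (hq : q ≠ 0) (t a : ℕ) : g.w t * g.x ^ a = (q⁻¹) ^ a • (g.x ^ a * g.w t) := by
  induction a with
  | zero => simp
  | succ a ih =>
    have h : g.w t * g.x = q⁻¹ • (g.x * g.w t) := by
      rw [g.x_mul_w, smul_smul, inv_mul_cancel₀ hq, one_smul]
    rw [pow_succ, ← mul_assoc, ih, smul_mul_assoc, mul_assoc, h, mul_smul_comm, smul_smul,
      ← pow_succ, ← mul_assoc]

theorem w_mul_mem (hq : q ≠ 0) (t : ℕ) {m : ℕ} {b : A} (hb : b ∈ g.fil m) :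
    g.w t * b ∈ g.fil (m + (t + 1)) := by
  refine g.mul_mem_fil (fun p => ?_) hb
  rw [mon, mul_assoc, ← mul_assoc, g.w_mul_x_pow hq, smul_mul_assoc, mul_assoc]
  exact Submodule.smul_mem _ _ (g.fil_mono (by simp only [wt]; omega)
    (g.x_pow_mul_mem _ (g.w_mul_y_pow_mul_wmon_mem hq _ _ _)))

theorem w_pow_mul_mem (hq : q ≠ 0) (t a : ℕ) {m : ℕ} {b : A} (hb : b ∈ g.fil m) :
    g.w t ^ a * b ∈ g.fil (m + (t + 1) * a) := by
  induction a with
  | zero => simpa using hb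
  | succ a ih =>
    rw [pow_succ', mul_assoc]
    exact g.fil_mono (by rw [mul_add]; omega) (g.w_mul_mem hq t ih)

theorem list_prod_mul_mem (hq : q ≠ 0) (n : Fin (G + 1) → ℕ) (l : List (Fin (G + 1)))
    {m : ℕ} {b : A} (hb : b ∈ g.fil m) : (l.map fun t : Fin (G + 1) => g.w t ^ n t).prod * b ∈
      g.fil (m + (l.map fun t : Fin (G + 1) => ((t : ℕ) + 1) * n t).sum) := by
  induction l with
  | nil => simpa using hb
  | cons i l ih =>
    simp only [List.map_cons, List.prod_cons, List.sum_cons, mul_assoc]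
    exact g.fil_mono (by omega) (g.w_pow_mul_mem hq i (n i) ih)

theorem mon_mul_mem (hq : q ≠ 0) (p : ℕ × ℕ × (Fin (G + 1) → ℕ)) {m : ℕ} {b : A}
    (hb : b ∈ g.fil m) : g.mon p * b ∈ g.fil (wt p + m) := by
  have h := g.x_pow_mul_mem p.1 (g.y_pow_mul_mem p.2.1
    (g.list_prod_mul_mem hq p.2.2 (List.finRange (G + 1)).reverse hb))
  rw [mon, mul_assoc, mul_assoc]
  refine g.fil_mono ?_ h
  rw [List.map_reverse, List.sum_reverse, ← List.ofFn_eq_map, List.sum_ofFn, wt]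
  omega

theorem fil_mul_fil_le (hq : q ≠ 0) (d m : ℕ) : g.fil d * g.fil m ≤ g.fil (d + m) := by
  refine Submodule.mul_le.2 fun a ha b hb => ?_
  induction ha using Submodule.span_induction with
  | mem a ha =>
    obtain ⟨p, hp, rfl⟩ := ha
    exact g.fil_mono (Nat.add_le_add_right hp m) (g.mon_mul_mem hq p hb)
  | zero => simp
  | add a c _ _ ha hc => rw [add_mul]; exact add_mem ha hc
  | smul c a _ ha => rw [smul_mul_assoc]; exact Submodule.smul_mem _ _ ha

theorem one_mem_fil : (1 : A) ∈ g.fil 0 := by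
  have : (1 : A) = g.mon (0, 0, 0) := by simp [mon, wmon]
  rw [this]
  exact g.mon_mem_fil (by simp [wt])

theorem fil_pow_le (hq : q ≠ 0) (d n : ℕ) : g.fil d ^ n ≤ g.fil (d * n) := by
  induction n with
  | zero => simpa [Submodule.one_le] using g.one_mem_fil
  | succ n ih =>
    rw [pow_succ]
    exact (mul_le_mul' ih le_rfl).trans (g.fil_mul_fil_le hq _ _)

theorem exists_mem_fil (hq : q ≠ 0) (hgen : Algebra.adjoin k {g.x, g.y, g.w 0} = ⊤) (a : A) :
    ∃ m, a ∈ g.fil m := by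
  have ha : a ∈ Algebra.adjoin k {g.x, g.y, g.w 0} := hgen ▸ Algebra.mem_top
  induction ha using Algebra.adjoin_induction with
  | mem a ha =>
    rcases ha with rfl | rfl | rfl
    · exact ⟨_, by simpa using g.x_mul_mem g.one_mem_fil⟩
    · exact ⟨_, by simpa using g.y_mul_mem g.one_mem_fil⟩
    · exact ⟨_, by simpa using g.w_mul_mem hq 0 g.one_mem_fil⟩
  | algebraMap r =>
    exact ⟨0, by rw [Algebra.algebraMap_eq_smul_one]; exact Submodule.smul_mem _ _ g.one_mem_fil⟩
  | add a b _ _ ha hb =>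
    obtain ⟨m, hm⟩ := ha
    obtain ⟨n, hn⟩ := hb
    exact ⟨max m n, add_mem (g.fil_mono (le_max_left _ _) hm) (g.fil_mono (le_max_right _ _) hn)⟩
  | mul a b _ _ ha hb =>
    obtain ⟨m, hm⟩ := ha
    obtain ⟨n, hn⟩ := hb
    exact ⟨m + n, g.fil_mul_fil_le hq m n (Submodule.mul_mem_mul hm hn)⟩

theorem span_range_mon (hq : q ≠ 0) (hgen : Algebra.adjoin k {g.x, g.y, g.w 0} = ⊤) :
    Submodule.span k (Set.range g.mon) = ⊤ := by
  refine eq_top_iff.2 fun a _ => ?_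
  obtain ⟨m, hm⟩ := g.exists_mem_fil hq hgen a
  exact Submodule.span_mono (Set.image_subset_range _ _) hm

/-- The exponents of the ordered monomials all of whose exponents are at most `m`. -/
def box (G m : ℕ) : Finset (ℕ × ℕ × (Fin (G + 1) → ℕ)) :=
  Finset.range (m + 1) ×ˢ Finset.range (m + 1) ×ˢ Fintype.piFinset fun _ => Finset.range (m + 1)

theorem card_box (G m : ℕ) : (box G m).card = (m + 1) ^ (G + 3) := by
  simp only [box, Finset.card_product, Finset.card_range, Fintype.card_piFinset,
    Finset.prod_const, Finset.card_univ, Fintype.card_fin]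
  ring

theorem mem_box_of_wt_le {p : ℕ × ℕ × (Fin (G + 1) → ℕ)} {m : ℕ} (h : wt p ≤ m) :
    p ∈ box G m := by
  have hn : ∀ t, p.2.2 t ≤ ∑ t : Fin (G + 1), ((t : ℕ) + 1) * p.2.2 t := fun t =>
    (Nat.le_mul_of_pos_left _ (Nat.succ_pos _)).trans
      (Finset.single_le_sum (f := fun t : Fin (G + 1) => ((t : ℕ) + 1) * p.2.2 t)
        (fun _ _ => Nat.zero_le _) (Finset.mem_univ t))
  simp only [wt] at h
  simp only [box, Finset.mem_product, Finset.mem_range, Fintype.mem_piFinset]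
  exact ⟨by omega, by omega, fun t => by have := hn t; omega⟩

theorem fil_le_span_box (m : ℕ) : g.fil m ≤ Submodule.span k (g.mon '' (box G m : Set _)) :=
  Submodule.span_mono (Set.image_mono fun _ hp => mem_box_of_wt_le hp)

theorem finite_fil (m : ℕ) : FiniteDimensional k (g.fil m) :=
  have : FiniteDimensional k (Submodule.span k (g.mon '' (box G m : Set _))) :=
    FiniteDimensional.span_of_finite k ((box G m).finite_toSet.image _)
  Submodule.finiteDimensional_of_le (g.fil_le_span_box m)

theorem finrank_fil_le (m : ℕ) : Module.finrank k (g.fil m) ≤ (m + 1) ^ (G + 3) := by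
  classical
  have hfin : FiniteDimensional k (Submodule.span k (g.mon '' (box G m : Set _))) :=
    FiniteDimensional.span_of_finite k ((box G m).finite_toSet.image _)
  refine (Submodule.finrank_mono (g.fil_le_span_box m)).trans ?_
  rw [← Finset.coe_image, ← card_box]
  exact (finrank_span_finset_le_card _).trans Finset.card_image_le

theorem exists_le_fil (hq : q ≠ 0) (hgen : Algebra.adjoin k {g.x, g.y, g.w 0} = ⊤)
    (V : Submodule k A) (hV : FiniteDimensional k V) : ∃ d, V ≤ g.fil d := by
  obtain ⟨s, hs⟩ := (Submodule.fg_iff_finiteDimensional V).2 hV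
  choose f hf using g.exists_mem_fil hq hgen
  refine ⟨s.sup f, ?_⟩
  rw [← hs, Submodule.span_le]
  exact fun a ha => g.fil_mono (Finset.le_sup ha) (hf a)

theorem sum_pow_le_fil (hq : q ≠ 0) {V : Submodule k A} {d : ℕ} (hV : V ≤ g.fil d) (n : ℕ) :
    ∑ j ∈ Finset.range (n + 1), V ^ j ≤ g.fil (d * n) := by
  refine Finset.sum_induction _ (· ≤ g.fil (d * n)) (fun a b ha hb => sup_le ha hb) bot_le ?_
  intro j hj
  have hj : j ≤ n := Nat.lt_succ_iff.1 (Finset.mem_range.1 hj)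
  exact (pow_le_pow_left' hV j).trans ((g.fil_pow_le hq d j).trans
    (g.fil_mono (Nat.mul_le_mul_left d hj)))

theorem finite_sum_pow (hq : q ≠ 0) (hgen : Algebra.adjoin k {g.x, g.y, g.w 0} = ⊤)
    (V : Submodule k A) (hV : FiniteDimensional k V) (n : ℕ) :
    FiniteDimensional k ↥(∑ j ∈ Finset.range (n + 1), V ^ j) := by
  obtain ⟨d, hd⟩ := g.exists_le_fil hq hgen V hV
  have := g.finite_fil (d * n)
  exact Submodule.finiteDimensional_of_le (g.sum_pow_le_fil hq hd n)

/-- The span of `1` and all the generators `x, y, w_0, …, w_G`. -/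
def genSpan : Submodule k A :=
  Submodule.span k ({1, g.x, g.y} ∪ Set.range fun t : Fin (G + 1) => g.w t)

theorem finite_genSpan : FiniteDimensional k g.genSpan :=
  FiniteDimensional.span_of_finite k ((Set.toFinite _).union (Set.finite_range _))

theorem one_le_genSpan : 1 ≤ g.genSpan := by
  rw [Submodule.one_le]
  exact Submodule.subset_span (by simp)

theorem list_prod_mem_genSpan_pow (n : Fin (G + 1) → ℕ) (l : List (Fin (G + 1))) :
    (l.map fun t : Fin (G + 1) => g.w t ^ n t).prod ∈ g.genSpan ^ (l.map n).sum := by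
  induction l with
  | nil => exact Submodule.one_le.1 (by simp)
  | cons i l ih =>
    simp only [List.map_cons, List.prod_cons, List.sum_cons, pow_add]
    refine Submodule.mul_mem_mul (Submodule.pow_mem_pow _ (Submodule.subset_span ?_) _) ih
    exact Or.inr ⟨i, rfl⟩

theorem mon_mem_genSpan_pow {p : ℕ × ℕ × (Fin (G + 1) → ℕ)} {m : ℕ} (hp : p ∈ box G m) :
    g.mon p ∈ g.genSpan ^ ((G + 3) * m) := by
  simp only [box, Finset.mem_product, Finset.mem_range, Fintype.mem_piFinset] at hp
  obtain ⟨ha, hb, hn⟩ := hp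
  have hmem : g.mon p ∈
      g.genSpan ^ (p.1 + p.2.1 + ((List.finRange (G + 1)).reverse.map p.2.2).sum) := by
    rw [pow_add, pow_add]
    refine Submodule.mul_mem_mul (Submodule.mul_mem_mul ?_ ?_) (g.list_prod_mem_genSpan_pow _ _)
    · exact Submodule.pow_mem_pow _ (Submodule.subset_span (by simp)) _
    · exact Submodule.pow_mem_pow _ (Submodule.subset_span (by simp)) _
  refine pow_le_pow_right' g.one_le_genSpan ?_ hmem
  rw [List.map_reverse, List.sum_reverse, ← List.ofFn_eq_map, List.sum_ofFn]
  have hs : ∑ t, p.2.2 t ≤ (G + 1) * m := by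
    simpa using Finset.sum_le_card_nsmul Finset.univ p.2.2 m fun t _ => Nat.lt_succ_iff.1 (hn t)
  linarith [Nat.lt_succ_iff.1 ha, Nat.lt_succ_iff.1 hb]

theorem le_finrank_sum_genSpan_pow (hq : q ≠ 0)
    (hgen : Algebra.adjoin k {g.x, g.y, g.w 0} = ⊤) (hli : LinearIndependent k g.mon) (n : ℕ) :
    (n / (G + 3) + 1) ^ (G + 3) ≤
      Module.finrank k ↥(∑ j ∈ Finset.range (n + 1), g.genSpan ^ j) := by
  have := g.finite_sum_pow hq hgen _ g.finite_genSpan n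
  set m := n / (G + 3)
  have hle : Submodule.span k (Set.range fun p : box G m => g.mon p) ≤
      ∑ j ∈ Finset.range (n + 1), g.genSpan ^ j := by
    rw [Submodule.span_le]
    rintro _ ⟨p, rfl⟩
    have hmn : (G + 3) * m ∈ Finset.range (n + 1) :=
      Finset.mem_range.2 (Nat.lt_succ_iff.2 (Nat.mul_div_le n (G + 3)))
    exact Finset.single_le_sum (f := fun j => g.genSpan ^ j) (fun _ _ => bot_le) hmn
      (g.mon_mem_genSpan_pow p.2)
  rw [← card_box, ← Fintype.card_coe,
    ← finrank_span_eq_card (hli.comp (fun p : box G m => (p : _ × _)) Subtype.val_injective)]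
  exact Submodule.finrank_mono hle

theorem limsup_le_of_le_fil (hq : q ≠ 0) {V : Submodule k A} {d : ℕ} (hV : V ≤ g.fil d) :
    Filter.limsup (fun n : ℕ => ENNReal.ofReal
      (Real.log ((Module.finrank k (↥(∑ j ∈ Finset.range (n + 1), V ^ j)) : ℕ) : ℝ) /
        Real.log (n : ℝ))) Filter.atTop ≤ (G : ℝ≥0∞) + 3 := by
  have hlog : Filter.Tendsto (fun n : ℕ => Real.log (n : ℝ)) Filter.atTop Filter.atTop :=
    Real.tendsto_log_atTop.comp tendsto_natCast_atTop_atTop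
  have hlim : Filter.Tendsto (fun n : ℕ => ENNReal.ofReal
      (((G : ℝ) + 3) * (Real.log ((d : ℝ) + 1) / Real.log (n : ℝ) + 1))) Filter.atTop
      (nhds ((G : ℝ≥0∞) + 3)) := by
    have h := ENNReal.tendsto_ofReal
      (((hlog.const_div_atTop (Real.log ((d : ℝ) + 1))).add_const 1).const_mul ((G : ℝ) + 3))
    have e : ENNReal.ofReal (((G : ℝ) + 3) * (0 + 1)) = (G : ℝ≥0∞) + 3 := by
      rw [zero_add, mul_one, ENNReal.ofReal_add (by positivity) (by positivity)]
      simp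
    rwa [e] at h
  rw [← hlim.limsup_eq]
  refine Filter.limsup_le_limsup ?_
  filter_upwards [Filter.eventually_ge_atTop 2] with n hn
  refine ENNReal.ofReal_le_ofReal ?_
  have hn' : (2 : ℝ) ≤ n := by exact_mod_cast hn
  have hpos : 0 < Real.log (n : ℝ) := Real.log_pos (by linarith)
  have hd : (0 : ℝ) ≤ d := Nat.cast_nonneg d
  have := g.finite_fil (d * n)
  have hr : Module.finrank k ↥(∑ j ∈ Finset.range (n + 1), V ^ j) ≤ (d * n + 1) ^ (G + 3) :=
    (Submodule.finrank_mono (g.sum_pow_le_fil hq hV n)).trans (g.finrank_fil_le _)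
  have hr' : (Module.finrank k ↥(∑ j ∈ Finset.range (n + 1), V ^ j) : ℝ) ≤
      (((d : ℝ) + 1) * n) ^ (G + 3) := by
    calc (Module.finrank k ↥(∑ j ∈ Finset.range (n + 1), V ^ j) : ℝ)
        ≤ ((d : ℝ) * n + 1) ^ (G + 3) := by exact_mod_cast hr
      _ ≤ _ := by gcongr; linarith
  have key : Real.log (Module.finrank k ↥(∑ j ∈ Finset.range (n + 1), V ^ j) : ℝ) ≤
      ((G : ℝ) + 3) * (Real.log ((d : ℝ) + 1) + Real.log n) := by
    have hd1 : (1 : ℝ) ≤ (d : ℝ) + 1 := by linarith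
    rcases Nat.eq_zero_or_pos (Module.finrank k ↥(∑ j ∈ Finset.range (n + 1), V ^ j)) with h | h
    · rw [h, Nat.cast_zero, Real.log_zero]
      have := Real.log_nonneg hd1
      positivity
    · refine (Real.log_le_log (by exact_mod_cast h) hr').trans_eq ?_
      rw [Real.log_pow, Real.log_mul (by positivity) (by positivity)]
      push_cast
      ring
  rw [div_le_iff₀ hpos]
  refine key.trans_eq ?_
  field_simp

theorem le_limsup_genSpan (hq : q ≠ 0)
    (hgen : Algebra.adjoin k {g.x, g.y, g.w 0} = ⊤) (hli : LinearIndependent k g.mon) :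
    (G : ℝ≥0∞) + 3 ≤ Filter.limsup (fun n : ℕ => ENNReal.ofReal
      (Real.log ((Module.finrank k (↥(∑ j ∈ Finset.range (n + 1), g.genSpan ^ j)) : ℕ) : ℝ) /
        Real.log (n : ℝ))) Filter.atTop := by
  have hlog : Filter.Tendsto (fun n : ℕ => Real.log (n : ℝ)) Filter.atTop Filter.atTop :=
    Real.tendsto_log_atTop.comp tendsto_natCast_atTop_atTop
  have hlim : Filter.Tendsto (fun n : ℕ => ENNReal.ofReal
      (((G : ℝ) + 3) * (-Real.log ((G : ℝ) + 3) / Real.log (n : ℝ) + 1))) Filter.atTop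
      (nhds ((G : ℝ≥0∞) + 3)) := by
    have h := ENNReal.tendsto_ofReal
      (((hlog.const_div_atTop (-Real.log ((G : ℝ) + 3))).add_const 1).const_mul ((G : ℝ) + 3))
    have e : ENNReal.ofReal (((G : ℝ) + 3) * (0 + 1)) = (G : ℝ≥0∞) + 3 := by
      rw [zero_add, mul_one, ENNReal.ofReal_add (by positivity) (by positivity)]
      simp
    rwa [e] at h
  rw [← hlim.limsup_eq]
  refine Filter.limsup_le_limsup ?_
  filter_upwards [Filter.eventually_ge_atTop 2] with n hn
  refine ENNReal.ofReal_le_ofReal ?_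
  have hn' : (2 : ℝ) ≤ n := by exact_mod_cast hn
  have hpos : 0 < Real.log (n : ℝ) := Real.log_pos (by linarith)
  have hr : (((n / (G + 3) + 1 : ℕ) : ℝ)) ^ (G + 3) ≤
      Module.finrank k ↥(∑ j ∈ Finset.range (n + 1), g.genSpan ^ j) := by
    exact_mod_cast g.le_finrank_sum_genSpan_pow hq hgen hli n
  have hm : (n : ℝ) / ((G : ℝ) + 3) ≤ ((n / (G + 3) + 1 : ℕ) : ℝ) := by
    rw [div_le_iff₀ (by positivity)]
    have : n ≤ (n / (G + 3) + 1) * (G + 3) := by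
      have := Nat.lt_div_mul_add (a := n) (b := G + 3) (by omega)
      rw [add_mul]; omega
    exact_mod_cast this
  have hr' : ((n : ℝ) / ((G : ℝ) + 3)) ^ (G + 3) ≤
      Module.finrank k ↥(∑ j ∈ Finset.range (n + 1), g.genSpan ^ j) :=
    (pow_le_pow_left₀ (by positivity) hm _).trans hr
  have key := Real.log_le_log (by positivity) hr'
  rw [Real.log_pow, Real.log_div (by positivity) (by positivity)] at key
  rw [le_div_iff₀ hpos]
  refine le_trans (le_of_eq ?_) key
  push_cast
  field_simp
  ring

theorem gkdim_eq (hq : q ≠ 0) (hgen : Algebra.adjoin k {g.x, g.y, g.w 0} = ⊤)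
    (hli : LinearIndependent k g.mon) : GKdim k A = (G : ℝ≥0∞) + 3 := by
  refine le_antisymm (iSup₂_le fun V hV => ?_) ?_
  · obtain ⟨d, hd⟩ := g.exists_le_fil hq hgen V hV
    exact g.limsup_le_of_le_fil hq hd
  · exact (g.le_limsup_genSpan hq hgen hli).trans
      (le_iSup₂_of_le g.genSpan g.finite_genSpan le_rfl)

end LstrGens

namespace LstrRep

variable {k : Type*} [Field k] (q : k) (G : ℕ)

/-- The commutative polynomial ring in `u` (the variable `none`) and `y_0, …, y_G`. -/
abbrev Poly (k : Type*) [Field k] (G : ℕ) : Type _ := MvPolynomial (Option (Fin (G + 1))) k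

/-- The automorphism fixing `u` and multiplying every `y_t` by `q`. -/
noncomputable def scale : Poly k G →ₐ[k] Poly k G :=
  MvPolynomial.aeval fun i => i.elim (MvPolynomial.X none) fun t => q • MvPolynomial.X (some t)

/-- The variable `y_t`, or `0` if `t > G`. -/
noncomputable def yvar (k : Type*) [Field k] (G t : ℕ) : Poly k G :=
  if h : t < G + 1 then MvPolynomial.X (some ⟨t, h⟩) else 0

theorem yvar_fin (t : Fin (G + 1)) : yvar k G t = MvPolynomial.X (some t) := by
  rw [yvar, dif_pos t.isLt]

/-- The derivation with `u ↦ -u² / 2` and `y_t ↦ q⁻¹ y_{t+1}`. -/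
noncomputable def der : Derivation k (Poly k G) (Poly k G) :=
  MvPolynomial.mkDerivation k fun i =>
    i.elim (-((2 : k)⁻¹ • (MvPolynomial.X none * MvPolynomial.X none)))
      fun t => q⁻¹ • yvar k G (t + 1)

@[simp]
theorem scale_u : scale q G (MvPolynomial.X none) = MvPolynomial.X none := by simp [scale]

@[simp]
theorem scale_yvar (t : ℕ) : scale q G (yvar k G t) = q • yvar k G t := by
  unfold yvar; split_ifs <;> simp [scale]

@[simp]
theorem der_u : der q G (MvPolynomial.X none) =
    -((2 : k)⁻¹ • (MvPolynomial.X none * MvPolynomial.X none)) := by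
  simp [der]

@[simp]
theorem der_yvar (t : ℕ) : der q G (yvar k G t) = q⁻¹ • yvar k G (t + 1) := by
  by_cases h : t < G + 1
  · simp [yvar, der, h]
  · simp [yvar, h, show ¬ t + 1 < G + 1 by omega]

theorem scale_der (f : Poly k G) : scale q G (der q G f) = der q G (scale q G f) := by
  induction f using MvPolynomial.induction_on with
  | C a => simp [← MvPolynomial.algebraMap_eq]
  | add f g hf hg => simp [hf, hg]
  | mul_X f i hf =>
    have hi : scale q G (der q G (MvPolynomial.X i)) = der q G (scale q G (MvPolynomial.X i)) := by
      cases i with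
      | none => simp
      | some t =>
        simp [← yvar_fin, smul_comm q]
    simp only [map_mul, Derivation.leibniz, map_add, smul_eq_mul, hf, hi]

theorem scale_pow_succ (t : ℕ) (f : Poly k G) :
    (scale q G ^ (t + 1)) f = (scale q G ^ t) (scale q G f) := by
  rw [pow_succ]; rfl

theorem scale_pow_succ' (t : ℕ) (f : Poly k G) :
    (scale q G ^ (t + 1)) f = scale q G ((scale q G ^ t) f) := by
  rw [pow_succ']; rfl

@[simp]
theorem scale_pow_yvar (s t : ℕ) : (scale q G ^ s) (yvar k G t) = q ^ s • yvar k G t := by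
  induction s with
  | zero => simp
  | succ s ih => rw [scale_pow_succ', ih, map_smul, scale_yvar, smul_smul, pow_succ]

theorem scale_pow_der (s : ℕ) (f : Poly k G) :
    (scale q G ^ s) (der q G f) = der q G ((scale q G ^ s) f) := by
  induction s with
  | zero => simp
  | succ s ih => rw [scale_pow_succ', ih, scale_der, ← scale_pow_succ']

/-- The operator `u σ` on sequences of polynomials. -/
noncomputable def opX : Module.End k (ℕ → Poly k G) where
  toFun f n := MvPolynomial.X none * scale q G (f n)
  map_add' f g := by ext1 n; simp [mul_add]
  map_smul' c f := by ext1 n; simp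

/-- The operator `(S + δ) σ` on sequences of polynomials, with `S` the right shift. -/
noncomputable def opY : Module.End k (ℕ → Poly k G) where
  toFun f n := scale q G (if n = 0 then 0 else f (n - 1)) + der q G (scale q G (f n))
  map_add' f g := by ext1 n; by_cases h : n = 0 <;> simp [h]; abel
  map_smul' c f := by ext1 n; by_cases h : n = 0 <;> simp [h]

/-- The operator `y_t σ ^ t` on sequences of polynomials. -/
noncomputable def opW (t : ℕ) : Module.End k (ℕ → Poly k G) where
  toFun f n := yvar k G t * (scale q G ^ t) (f n)
  map_add' f g := by ext1 n; simp [mul_add]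
  map_smul' c f := by ext1 n; simp

theorem opX_apply (f : ℕ → Poly k G) (n : ℕ) :
    opX q G f n = MvPolynomial.X none * scale q G (f n) := rfl

theorem opY_apply (f : ℕ → Poly k G) (n : ℕ) : opY q G f n =
    scale q G (if n = 0 then 0 else f (n - 1)) + der q G (scale q G (f n)) := rfl

theorem opW_apply (t : ℕ) (f : ℕ → Poly k G) (n : ℕ) :
    opW q G t f n = yvar k G t * (scale q G ^ t) (f n) := rfl

/-- A representation of `B(lstr(1,G))` on sequences of polynomials. -/
noncomputable def gens (hq : q ≠ 0) : LstrGens k q G (Module.End k (ℕ → Poly k G)) where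
  x := opX q G
  y := opY q G
  w := opW q G
  jordan := by
    ext1 f
    ext1 n
    simp only [Module.End.mul_apply, LinearMap.sub_apply, LinearMap.smul_apply, Pi.sub_apply,
      Pi.smul_apply, opX_apply, opY_apply]
    by_cases h : n = 0
    · simp only [h, if_true, map_zero, zero_add, map_mul, scale_u, Derivation.leibniz,
        scale_der, der_u, smul_eq_mul, MvPolynomial.smul_eq_C_mul]
      ring
    · simp only [h, if_false, map_mul, map_add, scale_u, Derivation.leibniz, scale_der, der_u,
        smul_eq_mul, MvPolynomial.smul_eq_C_mul]
      ring
  weak := by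
    ext1 f
    ext1 n
    simp only [Module.End.mul_apply, LinearMap.smul_apply, Pi.smul_apply, opX_apply, opW_apply,
      pow_zero, AlgHom.one_apply, map_mul, scale_yvar, MvPolynomial.smul_eq_C_mul]
    ring
  w_succ t := by
    ext1 f
    ext1 n
    have hs : ∀ f, (scale q G ^ t) (scale q G f) = scale q G ((scale q G ^ t) f) := fun f => by
      rw [← scale_pow_succ, scale_pow_succ']
    have hC : (MvPolynomial.C q * MvPolynomial.C q⁻¹ : Poly k G) = 1 := by
      rw [← MvPolynomial.C_mul, mul_inv_cancel₀ hq, MvPolynomial.C_1]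
    simp only [Module.End.mul_apply, LinearMap.sub_apply, LinearMap.smul_apply, Pi.sub_apply,
      Pi.smul_apply, opW_apply, opY_apply]
    by_cases h : n = 0
    · simp only [h, if_true, map_zero, zero_add, map_mul, scale_yvar,
        Derivation.leibniz, MvPolynomial.derivation_C, der_yvar, scale_pow_der, hs, scale_pow_succ',
        smul_eq_mul, MvPolynomial.smul_eq_C_mul]
      linear_combination (-yvar k G (t + 1) * scale q G ((scale q G ^ t) (f 0))) * hC
    · simp only [h, if_false, map_mul, map_add, scale_yvar,
        Derivation.leibniz, MvPolynomial.derivation_C, der_yvar, scale_pow_der, hs, scale_pow_succ',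
        smul_eq_mul, MvPolynomial.smul_eq_C_mul]
      linear_combination (-yvar k G (t + 1) * scale q G ((scale q G ^ t) (f n))) * hC
  ghost := by
    ext1 f
    ext1 n
    simp [opW_apply, yvar]
  qcomm_succ t _ := by
    ext1 f
    ext1 n
    have h : (scale q G ^ t) ((scale q G ^ (t + 1)) (f n)) =
        (scale q G ^ (t + 1)) ((scale q G ^ t) (f n)) :=
      DFunLike.congr_fun (pow_mul_comm (scale q G) t (t + 1)) (f n)
    have hq' : q⁻¹ * q ^ (t + 1) = q ^ t := by rw [pow_succ', inv_mul_cancel_left₀ hq]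
    simp only [Module.End.mul_apply, LinearMap.smul_apply, Pi.smul_apply, opW_apply, map_mul,
      scale_pow_yvar, h, smul_mul_assoc, mul_smul_comm, smul_smul, hq']
    rw [mul_left_comm]

theorem exists_scale_monomial (hq : q ≠ 0) (m : Option (Fin (G + 1)) →₀ ℕ) : ∃ c : k, c ≠ 0 ∧
    scale q G (MvPolynomial.monomial m 1) = c • MvPolynomial.monomial m 1 := by
  induction m using Finsupp.induction_linear with
  | zero => exact ⟨1, one_ne_zero, by simp⟩
  | add m n hm hn =>
    obtain ⟨c, hc, hm⟩ := hm
    obtain ⟨d, hd, hn⟩ := hn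
    refine ⟨c * d, mul_ne_zero hc hd, ?_⟩
    rw [← one_mul (1 : k), ← MvPolynomial.monomial_mul, map_mul, hm, hn, smul_mul_smul_comm]
  | single i e =>
    rw [← MvPolynomial.X_pow_eq_monomial, map_pow]
    cases i with
    | none => exact ⟨1, one_ne_zero, by simp⟩
    | some t => exact ⟨q ^ e, pow_ne_zero _ hq, by simp [scale, smul_pow]⟩

theorem exists_scale_pow_monomial (hq : q ≠ 0) (m : Option (Fin (G + 1)) →₀ ℕ) (s : ℕ) :
    ∃ c : k, c ≠ 0 ∧
      (scale q G ^ s) (MvPolynomial.monomial m 1) = c • MvPolynomial.monomial m 1 := by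
  obtain ⟨c, hc, h⟩ := exists_scale_monomial q G hq m
  refine ⟨c ^ s, pow_ne_zero _ hc, ?_⟩
  induction s with
  | zero => simp
  | succ s ih => rw [scale_pow_succ', ih, map_smul, h, smul_smul, pow_succ]

theorem opW_single (t : Fin (G + 1)) (f : Poly k G) :
    opW q G t (Pi.single 0 f) =
      Pi.single 0 (MvPolynomial.X (some t) * (scale q G ^ (t : ℕ)) f) := by
  ext1 n
  rw [opW_apply]
  by_cases h : n = 0
  · subst h; simp only [Pi.single_eq_same, yvar_fin]
  · simp [h]

theorem exists_opW_pow_single (hq : q ≠ 0) (t : Fin (G + 1)) (e : ℕ)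
    (m : Option (Fin (G + 1)) →₀ ℕ) : ∃ c : k, c ≠ 0 ∧
      (opW q G t ^ e) (Pi.single 0 (MvPolynomial.monomial m 1)) =
        c • (Pi.single 0 (MvPolynomial.monomial (Finsupp.single (some t) e + m) 1) :
          ℕ → Poly k G) := by
  induction e with
  | zero => exact ⟨1, one_ne_zero, by simp⟩
  | succ e ih =>
    obtain ⟨c, hc, h⟩ := ih
    obtain ⟨d, hd, h'⟩ := exists_scale_pow_monomial q G hq (Finsupp.single (some t) e + m) t
    refine ⟨c * d, mul_ne_zero hc hd, ?_⟩
    rw [pow_succ', Module.End.mul_apply, h, map_smul, opW_single, h', mul_smul_comm,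
      Pi.single_smul, smul_smul, MvPolynomial.X, MvPolynomial.monomial_mul, one_mul,
      ← add_assoc, ← Finsupp.single_add, add_comm 1 e]

theorem exists_list_prod_single (hq : q ≠ 0) (n : Fin (G + 1) → ℕ) (l : List (Fin (G + 1))) :
    ∃ c : k, c ≠ 0 ∧ (l.map fun t : Fin (G + 1) => opW q G t ^ n t).prod
        (Pi.single 0 (MvPolynomial.monomial 0 1)) =
      c • (Pi.single 0 (MvPolynomial.monomial
        (l.map fun t => Finsupp.single (some t) (n t)).sum 1) : ℕ → Poly k G) := by
  induction l with
  | nil => exact ⟨1, one_ne_zero, by simp⟩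
  | cons i l ih =>
    obtain ⟨c, hc, h⟩ := ih
    obtain ⟨d, hd, h'⟩ := exists_opW_pow_single q G hq i (n i)
      (l.map fun t => Finsupp.single (some t) (n t)).sum
    refine ⟨c * d, mul_ne_zero hc hd, ?_⟩
    rw [List.map_cons, List.prod_cons, Module.End.mul_apply, h, map_smul, h', smul_smul,
      List.map_cons, List.sum_cons]

theorem opY_pow_single (f : Poly k G) (b : ℕ) :
    (opY q G ^ b) (Pi.single 0 f) b = (scale q G ^ b) f ∧
      ∀ n, b < n → (opY q G ^ b) (Pi.single 0 f) n = 0 := by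
  induction b with
  | zero => exact ⟨by simp, fun n hn => by simp [hn.ne']⟩
  | succ b ih =>
    rw [pow_succ']
    refine ⟨?_, fun n hn => ?_⟩
    · rw [Module.End.mul_apply, opY_apply, ih.2 (b + 1) (Nat.lt_succ_self b)]
      simp [ih.1, scale_pow_succ']
    · rw [Module.End.mul_apply, opY_apply, ih.2 n (by omega), if_neg (by omega),
        ih.2 (n - 1) (by omega)]
      simp

theorem opX_pow_apply (a : ℕ) (f : ℕ → Poly k G) (n : ℕ) :
    (opX q G ^ a) f n = MvPolynomial.X none ^ a * (scale q G ^ a) (f n) := by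
  induction a with
  | zero => simp
  | succ a ih =>
    rw [pow_succ', Module.End.mul_apply, opX_apply, ih, map_mul, map_pow, scale_u,
      ← scale_pow_succ', pow_succ' (MvPolynomial.X none), mul_assoc]

/-- The exponent vector of `u ^ m₁ * ∏ t, y_t ^ n_t`. -/
noncomputable def expo (p : ℕ × ℕ × (Fin (G + 1) → ℕ)) : Option (Fin (G + 1)) →₀ ℕ :=
  Finsupp.single none p.1 +
    ((List.finRange (G + 1)).reverse.map fun t => Finsupp.single (some t) (p.2.2 t)).sum

theorem expo_none (p : ℕ × ℕ × (Fin (G + 1) → ℕ)) : expo G p none = p.1 := by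
  rw [expo, List.map_reverse, List.sum_reverse, ← List.ofFn_eq_map, List.sum_ofFn]
  simp

theorem expo_some (p : ℕ × ℕ × (Fin (G + 1) → ℕ)) (t : Fin (G + 1)) :
    expo G p (some t) = p.2.2 t := by
  rw [expo, List.map_reverse, List.sum_reverse, ← List.ofFn_eq_map, List.sum_ofFn]
  simp [Finsupp.single_apply]

theorem eq_of_expo_eq {p r : ℕ × ℕ × (Fin (G + 1) → ℕ)} (h : p.2.1 = r.2.1)
    (he : expo G p = expo G r) : p = r := by
  refine Prod.ext ?_ (Prod.ext h (funext fun t => ?_))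
  · rw [← expo_none G p, he, expo_none]
  · rw [← expo_some G p, he, expo_some]

/-- The leading term of an ordered monomial applied to the constant sequence `1, 0, 0, …`. -/
theorem exists_mon_apply (hq : q ≠ 0) (p : ℕ × ℕ × (Fin (G + 1) → ℕ)) :
    ∃ c : k, c ≠ 0 ∧
      (gens q G hq).mon p (Pi.single 0 (MvPolynomial.monomial 0 1)) p.2.1 =
        c • MvPolynomial.monomial (expo G p) 1 ∧
      ∀ n, p.2.1 < n → (gens q G hq).mon p (Pi.single 0 (MvPolynomial.monomial 0 1)) n = 0 := by
  obtain ⟨c, hc, h⟩ := exists_list_prod_single q G hq p.2.2 (List.finRange (G + 1)).reverse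
  set m := ((List.finRange (G + 1)).reverse.map fun t => Finsupp.single (some t) (p.2.2 t)).sum
  obtain ⟨d, hd, h'⟩ := exists_scale_pow_monomial q G hq m (p.1 + p.2.1)
  have hY := opY_pow_single q G (MvPolynomial.monomial m 1) p.2.1
  have hmon : ∀ n, (gens q G hq).mon p (Pi.single 0 (MvPolynomial.monomial 0 1)) n =
      c • (MvPolynomial.X none ^ p.1 * (scale q G ^ p.1)
        ((opY q G ^ p.2.1) (Pi.single 0 (MvPolynomial.monomial m 1)) n)) := by
    intro n
    change (opX q G ^ p.1 * opY q G ^ p.2.1 *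
      ((List.finRange (G + 1)).reverse.map fun t : Fin (G + 1) => opW q G t ^ p.2.2 t).prod)
        _ n = _
    rw [Module.End.mul_apply, Module.End.mul_apply, h, map_smul, map_smul, Pi.smul_apply,
      opX_pow_apply]
  refine ⟨c * d, mul_ne_zero hc hd, ?_, fun n hn => ?_⟩
  · rw [hmon, hY.1, ← AlgHom.mul_apply, ← pow_add, h', mul_smul_comm, smul_smul,
      MvPolynomial.X_pow_eq_monomial, MvPolynomial.monomial_mul, one_mul, expo]
  · rw [hmon, hY.2 n hn]
    simp

theorem linearIndependent_mon (hq : q ≠ 0) : LinearIndependent k (gens q G hq).mon := by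
  choose c hc htop hzero using exists_mon_apply q G hq
  rw [linearIndependent_iff]
  intro l hl
  by_contra hne
  obtain ⟨p, hp, hmax⟩ := l.support.exists_max_image (fun p => p.2.1)
    (Finsupp.support_nonempty_iff.2 hne)
  have h0 : MvPolynomial.coeff (expo G p) (Finsupp.linearCombination k (gens q G hq).mon l
      (Pi.single 0 (MvPolynomial.monomial 0 1)) p.2.1) = 0 := by
    rw [hl]; simp
  rw [Finsupp.linearCombination_apply, Finsupp.sum, LinearMap.sum_apply, Finset.sum_apply,
    MvPolynomial.coeff_sum, Finset.sum_eq_single p] at h0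
  · rw [LinearMap.smul_apply, Pi.smul_apply, htop, MvPolynomial.coeff_smul,
      MvPolynomial.coeff_smul, MvPolynomial.coeff_monomial, if_pos rfl] at h0
    simp [hc p, Finsupp.mem_support_iff.1 hp] at h0
  · intro r hr hrp
    rw [LinearMap.smul_apply, Pi.smul_apply, MvPolynomial.coeff_smul]
    rcases (hmax r hr).lt_or_eq with h | h
    · rw [hzero r _ h]; simp
    · rw [← h, htop, MvPolynomial.coeff_smul, MvPolynomial.coeff_monomial,
        if_neg fun he => hrp (eq_of_expo_eq G h he)]
      simp
  · exact fun h => absurd hp h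

end LstrRep

/-- The generators of `B(lstr(1,G))`. -/
noncomputable def lstrGens (k : Type*) [Field k] (q : k) (G : ℕ) :
    LstrGens k q G (RingQuot (lstrRel k q G)) where
  x := RingQuot.mkAlgHom k _ (X k 0)
  y := RingQuot.mkAlgHom k _ (X k 1)
  w t := RingQuot.mkAlgHom k _ (z k q t)
  jordan := by
    have h := RingQuot.mkAlgHom_rel k (s := lstrRel k q G) ⟨rfl, Or.inl rfl⟩
    rw [map_zero, map_add, map_sub, map_smul, map_mul, map_mul, map_mul] at h
    rw [← sub_eq_zero, ← h]
    abel
  weak := by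
    have h := RingQuot.mkAlgHom_rel k (s := lstrRel k q G) ⟨rfl, Or.inr (Or.inl rfl)⟩
    rw [map_zero, map_sub, map_smul, map_mul, map_mul, sub_eq_zero] at h
    exact h
  w_succ t := by rw [z, map_sub, map_smul, map_mul, map_mul]
  ghost := by
    have h := RingQuot.mkAlgHom_rel k (s := lstrRel k q G) ⟨rfl, Or.inr (Or.inr (Or.inl rfl))⟩
    rwa [map_zero] at h
  qcomm_succ t ht := by
    have h := RingQuot.mkAlgHom_rel k (s := lstrRel k q G)
      ⟨rfl, Or.inr (Or.inr (Or.inr ⟨t, ht, rfl⟩))⟩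
    rw [map_zero, map_sub, map_smul, map_mul, map_mul, sub_eq_zero] at h
    exact h

theorem bas_eq_mon (k : Type*) [Field k] (q : k) (G : ℕ) : bas k q G = (lstrGens k q G).mon := by
  funext p
  simp only [bas, map_mul, map_pow, map_list_prod, List.map_reverse, List.map_ofFn,
    LstrGens.mon, LstrGens.wmon, lstrGens]
  rw [← List.ofFn_eq_map]
  congr 4
  funext t
  simp

theorem adjoin_lstrGens (k : Type*) [Field k] (q : k) (G : ℕ) :
    Algebra.adjoin k {(lstrGens k q G).x, (lstrGens k q G).y, (lstrGens k q G).w 0} = ⊤ := by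
  refine eq_top_iff.2 fun a _ => ?_
  obtain ⟨f, rfl⟩ := RingQuot.mkAlgHom_surjective k (lstrRel k q G) a
  induction f using FreeAlgebra.induction with
  | grade0 r => rw [AlgHom.commutes]; exact Subalgebra.algebraMap_mem _ r
  | grade1 i =>
    refine Algebra.subset_adjoin ?_
    fin_cases i
    · exact Or.inl rfl
    · exact Or.inr (Or.inl rfl)
    · exact Or.inr (Or.inr rfl)
  | mul a b ha hb => rw [map_mul]; exact mul_mem (ha trivial) (hb trivial)
  | add a b ha hb => rw [map_add]; exact add_mem (ha trivial) (hb trivial)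

/-- Generators satisfying the relations of `B(lstr(1,G))` define a representation of it. -/
theorem LstrGens.exists_algHom {k : Type*} [Field k] {q : k} {G : ℕ} {A : Type*} [Ring A]
    [Algebra k A] (g : LstrGens k q G A) :
    ∃ φ : RingQuot (lstrRel k q G) →ₐ[k] A, ∀ p, φ (bas k q G p) = g.mon p := by
  let F : FreeAlgebra k (Fin 3) →ₐ[k] A := FreeAlgebra.lift k ![g.x, g.y, g.w 0]
  have hx : F (X k 0) = g.x := by simp [F, X]
  have hy : F (X k 1) = g.y := by simp [F, X]
  have hw : ∀ t, F (z k q t) = g.w t := by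
    intro t
    induction t with
    | zero => simp [F, z, X]
    | succ t ih => rw [z, map_sub, map_smul, map_mul, map_mul, ih, hy, g.w_succ]
  have hrel : ∀ ⦃a b⦄, lstrRel k q G a b → F a = F b := by
    rintro a b ⟨rfl, rfl | rfl | rfl | ⟨t, ht, rfl⟩⟩
    · simp only [map_add, map_sub, map_smul, map_mul, hx, hy, g.jordan, map_zero]
      abel
    · have h0 : F (X k 2) = g.w 0 := hw 0
      simp only [map_sub, map_smul, map_mul, hx, h0, g.weak, map_zero, sub_self]
    · rw [hw, g.ghost, map_zero]
    · simp only [map_sub, map_smul, map_mul, hw, g.qcomm_succ t ht, map_zero, sub_self]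
  refine ⟨RingQuot.liftAlgHom k ⟨F, hrel⟩, fun p => ?_⟩
  rw [bas, RingQuot.liftAlgHom_mkAlgHom_apply]
  simp only [map_mul, map_pow, map_list_prod, List.map_reverse, List.map_ofFn, hx, hy,
    LstrGens.mon, LstrGens.wmon]
  rw [← List.ofFn_eq_map]
  congr 4
  funext t
  simp [hw]

/-- The PBW monomials form a basis of `B(lstr(1,G))`, and
`GKdim B(lstr(1,G)) = G + 3`. -/
theorem statement8 (k : Type*) [Field k] [IsAlgClosed k] [CharZero k]
    (q : k) (hq : q ≠ 0) (G : ℕ) (hG : 1 ≤ G) :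
    (LinearIndependent k (bas k q G) ∧
      Submodule.span k (Set.range (bas k q G)) = ⊤) ∧
    GKdim k (RingQuot (lstrRel k q G)) = (G : ℝ≥0∞) + 3 := by
  have hli : LinearIndependent k (bas k q G) := by
    obtain ⟨φ, hφ⟩ := (LstrRep.gens q G hq).exists_algHom
    refine LinearIndependent.of_comp φ.toLinearMap ?_
    have : φ.toLinearMap ∘ bas k q G = (LstrRep.gens q G hq).mon := funext hφ
    rw [this]
    exact LstrRep.linearIndependent_mon q G hq
  rw [bas_eq_mon] at hli ⊢
  exact ⟨⟨hli, (lstrGens k q G).span_range_mon hq (adjoin_lstrGens k q G)⟩,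
    (lstrGens k q G).gkdim_eq hq (adjoin_lstrGens k q G) hli⟩
end

section
/- Let k be an algebraically closed field of characteristic 0, q ∈ k^× and G ∈ ℕ with G ≥ 1. In the free algebra k⟨x_1,x_2,x_3⟩ define z_0 := x_3 and z_{t+1} := x_2·z_t − q·z_t·x_2 for t ≥ 0, and let A be the quotient of k⟨x_1,x_2,x_3⟩ by the two-sided ideal generated by: x_2x_1 − x_1x_2 + (1/2)x_1², x_1x_3 − q·x_3x_1, z_{G+1}, and z_t·z_{t+1} − q^{−1}·z_{t+1}·z_t for 0 ≤ t < G. Then A is a domain (A has no nonzero zero divisors). -/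
/-- A `k`-algebra endomorphism `σ` of `R` together with a `k`-linear `σ`-derivation `δ`. -/
structure SkewDerivation (k R : Type*) [CommRing k] [Ring R] [Algebra k R] where
  /-- The twisting endomorphism. -/
  σ : R →ₐ[k] R
  /-- The `σ`-derivation. -/
  δ : R →ₗ[k] R
  leibniz : ∀ a b, δ (a * b) = σ a * δ b + δ a * b

/-- The Ore extension `R[x; σ, δ]`, in which `x * r = σ r * x + δ r`; its elements are
polynomials with coefficients on the left. -/
def OreExtension {k R : Type*} [CommRing k] [Ring R] [Algebra k R]
    (_ : SkewDerivation k R) : Type _ := Polynomial R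

namespace OreExtension

variable {k R C : Type*} [CommRing k] [Ring R] [Algebra k R] [Ring C] [Algebra k C]

/-- The linear map `∑ rᵢ Xⁱ ↦ ∑ f rᵢ * cⁱ`. -/
noncomputable def evalLinear (f : R →ₐ[k] C) (c : C) : Polynomial R →ₗ[k] C :=
  Polynomial.lsum fun n => LinearMap.mulRight k (c ^ n) ∘ₗ f.toLinearMap

theorem evalLinear_monomial (f : R →ₐ[k] C) (c : C) (n : ℕ) (r : R) :
    evalLinear f c (Polynomial.monomial n r) = f r * c ^ n := by
  simp [evalLinear, Polynomial.lsum, Polynomial.sum_monomial_index]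

theorem linearMap_ext {M : Type*} [AddCommGroup M] [Module k M]
    {f g : Polynomial R →ₗ[k] M}
    (h : ∀ n r, f (Polynomial.monomial n r) = g (Polynomial.monomial n r)) : f = g := by
  ext p
  induction p using Polynomial.induction_on' with
  | add p q hp hq => rw [map_add, map_add, hp, hq]
  | monomial n r => exact h n r

variable (d : SkewDerivation k R)

/-- Left multiplication by the variable `x` of the Ore extension. -/
noncomputable def shift : Module.End k (Polynomial R) :=
  Polynomial.lsum fun n =>
    (Polynomial.monomial (n + 1)).restrictScalars k ∘ₗ d.σ.toLinearMap +
      (Polynomial.monomial n).restrictScalars k ∘ₗ d.δ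

theorem shift_monomial (n : ℕ) (r : R) :
    shift d (Polynomial.monomial n r) =
      Polynomial.monomial (n + 1) (d.σ r) + Polynomial.monomial n (d.δ r) := by
  simp [shift, Polynomial.lsum, Polynomial.sum_monomial_index]

theorem coeff_shift (p : Polynomial R) (n : ℕ) :
    (shift d p).coeff (n + 1) = d.σ (p.coeff n) + d.δ (p.coeff (n + 1)) := by
  induction p using Polynomial.induction_on' with
  | add p q hp hq =>
    simp only [map_add, Polynomial.coeff_add, hp, hq]
    abel
  | monomial m r =>
    simp only [shift_monomial, Polynomial.coeff_add, Polynomial.coeff_monomial,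
      Nat.add_right_cancel_iff]
    split_ifs <;> simp

/-- Left multiplication by constants. -/
noncomputable def constMul (k R : Type*) [CommRing k] [Ring R] [Algebra k R] :
    R →ₐ[k] Module.End k (Polynomial R) :=
  (Algebra.lmul k (Polynomial R)).comp Polynomial.CAlgHom

theorem constMul_apply (r : R) (p : Polynomial R) :
    constMul k R r p = Polynomial.C r * p := rfl

/-- Left multiplication in the Ore extension. -/
noncomputable def mulLeft : Polynomial R →ₗ[k] Module.End k (Polynomial R) :=
  evalLinear (constMul k R) (shift d)

theorem evalLinear_shift {f : R →ₐ[k] C} {c : C}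
    (h : ∀ r, c * f r = f (d.σ r) * c + f (d.δ r)) (p : Polynomial R) :
    evalLinear f c (shift d p) = c * evalLinear f c p := by
  refine LinearMap.congr_fun (f := evalLinear f c ∘ₗ shift d)
    (g := LinearMap.mulLeft k c ∘ₗ evalLinear f c) (linearMap_ext fun n r => ?_) p
  simp [shift_monomial, evalLinear_monomial, ← mul_assoc, h, pow_succ', add_mul]

theorem evalLinear_constMul (f : R →ₐ[k] C) (c : C) (r : R) (p : Polynomial R) :
    evalLinear f c (constMul k R r p) = f r * evalLinear f c p := by
  refine LinearMap.congr_fun (f := evalLinear f c ∘ₗ constMul k R r)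
    (g := LinearMap.mulLeft k (f r) ∘ₗ evalLinear f c) (linearMap_ext fun n s => ?_) p
  simp [constMul_apply, Polynomial.C_mul_monomial, evalLinear_monomial, mul_assoc]

theorem evalLinear_mulLeft {f : R →ₐ[k] C} {c : C}
    (h : ∀ r, c * f r = f (d.σ r) * c + f (d.δ r)) (p q : Polynomial R) :
    evalLinear f c (mulLeft d p q) = evalLinear f c p * evalLinear f c q := by
  induction p using Polynomial.induction_on' with
  | add p p' hp hp' => simp only [map_add, LinearMap.add_apply, hp, hp', add_mul]
  | monomial n r =>
    rw [mulLeft, evalLinear_monomial, evalLinear_monomial, Module.End.mul_apply,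
      evalLinear_constMul, mul_assoc]
    congr 1
    induction n with
    | zero => simp
    | succ n ih =>
      rw [pow_succ', pow_succ', Module.End.mul_apply, evalLinear_shift d h, ih, mul_assoc]

theorem shift_mul_constMul (r : R) :
    shift d * constMul k R r = constMul k R (d.σ r) * shift d + constMul k R (d.δ r) := by
  refine linearMap_ext fun n s => ?_
  simp [constMul_apply, Polynomial.C_mul_monomial, shift_monomial, d.leibniz, mul_add, add_assoc]

theorem mulLeft_monomial (n : ℕ) (r : R) :
    mulLeft d (Polynomial.monomial n r) = constMul k R r * shift d ^ n :=
  evalLinear_monomial _ _ _ _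

theorem mulLeft_C (r : R) : mulLeft d (Polynomial.C r) = constMul k R r := by
  rw [← Polynomial.monomial_zero_left, mulLeft_monomial, pow_zero, mul_one]

theorem mulLeft_mulLeft (p q : Polynomial R) :
    mulLeft d (mulLeft d p q) = mulLeft d p * mulLeft d q :=
  evalLinear_mulLeft d (shift_mul_constMul d) p q

theorem mulLeft_one : mulLeft d 1 = 1 := by
  rw [← Polynomial.monomial_zero_one, mulLeft_monomial, map_one, pow_zero, mul_one]

theorem shift_pow_one (n : ℕ) : (shift d ^ n) 1 = Polynomial.monomial n 1 := by
  induction n with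
  | zero => simp
  | succ n ih =>
    have h1 : d.δ 1 = 0 := by simpa using d.leibniz 1 1
    rw [pow_succ', Module.End.mul_apply, ih, shift_monomial, map_one, h1, map_zero, add_zero]

theorem mulLeft_apply_one (p : Polynomial R) : mulLeft d p 1 = p := by
  induction p using Polynomial.induction_on' with
  | add p q hp hq => rw [map_add, LinearMap.add_apply, hp, hq]
  | monomial n r =>
    rw [mulLeft_monomial, Module.End.mul_apply, shift_pow_one, constMul_apply,
      Polynomial.C_mul_monomial, mul_one]

noncomputable instance : AddCommGroup (OreExtension d) :=
  inferInstanceAs (AddCommGroup (Polynomial R))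

noncomputable instance : Module k (OreExtension d) :=
  inferInstanceAs (Module k (Polynomial R))

/-- The linear identification of polynomials with elements of the Ore extension. -/
noncomputable def ofPoly : Polynomial R ≃ₗ[k] OreExtension d := LinearEquiv.refl k (Polynomial R)

noncomputable instance : Ring (OreExtension d) where
  mul p q := ofPoly d (mulLeft d ((ofPoly d).symm p) ((ofPoly d).symm q))
  one := ofPoly d 1
  mul_assoc p q r := LinearMap.congr_fun (mulLeft_mulLeft d p q) r
  one_mul p := LinearMap.congr_fun (mulLeft_one d) p
  mul_one p := mulLeft_apply_one d p
  left_distrib p q r := map_add (mulLeft d p) q r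
  right_distrib p q r := by
    change mulLeft d ((ofPoly d).symm p + (ofPoly d).symm q) r = _
    rw [map_add]
    rfl
  zero_mul p := by
    change mulLeft d 0 p = _
    rw [map_zero]
    rfl
  mul_zero p := map_zero (mulLeft d p)
  neg_add_cancel := neg_add_cancel
  zsmul := zsmulRec

theorem ofPoly_mulLeft (p q : Polynomial R) :
    ofPoly d (mulLeft d p q) = ofPoly d p * ofPoly d q := rfl

noncomputable instance : Algebra k (OreExtension d) :=
  Algebra.ofModule
    (fun c p q => by
      change mulLeft d (c • (ofPoly d).symm p) q = _
      rw [map_smul]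
      rfl)
    (fun c p q => map_smul (mulLeft d p) c q)

/-- The inclusion of the coefficient ring. -/
noncomputable def const : R →ₐ[k] OreExtension d :=
  AlgHom.ofLinearMap ((ofPoly d).toLinearMap ∘ₗ Polynomial.CAlgHom.toLinearMap) rfl
    (fun r s => by
      change ofPoly d (Polynomial.C (r * s)) =
        ofPoly d (mulLeft d (Polynomial.C r) (Polynomial.C s))
      rw [mulLeft_C, constMul_apply, map_mul])

/-- The variable of the Ore extension. -/
noncomputable def var : OreExtension d := ofPoly d (Polynomial.monomial 1 1)

theorem ofPoly_C (r : R) : ofPoly d (Polynomial.C r) = const d r := rfl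

theorem var_mul_const (r : R) :
    var d * const d r = const d (d.σ r) * var d + const d (d.δ r) := by
  rw [var, ← ofPoly_C, ← ofPoly_C, ← ofPoly_C, ← ofPoly_mulLeft, ← ofPoly_mulLeft, ← map_add,
    mulLeft_C, mulLeft_monomial, constMul_apply, Polynomial.C_mul_monomial, mul_one, map_one,
    one_mul, pow_one, ← Polynomial.monomial_zero_left, shift_monomial,
    Polynomial.monomial_zero_left]

variable {d}

/-- The universal property of the Ore extension. -/
noncomputable def lift (f : R →ₐ[k] C) (c : C)
    (h : ∀ r, c * f r = f (d.σ r) * c + f (d.δ r)) : OreExtension d →ₐ[k] C :=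
  AlgHom.ofLinearMap (evalLinear f c ∘ₗ (ofPoly d).symm.toLinearMap)
    (by
      change evalLinear f c 1 = 1
      rw [← Polynomial.monomial_zero_one, evalLinear_monomial, map_one, pow_zero, mul_one])
    (evalLinear_mulLeft d h)

@[simp]
theorem lift_const (f : R →ₐ[k] C) (c : C)
    (h : ∀ r, c * f r = f (d.σ r) * c + f (d.δ r)) (r : R) : lift f c h (const d r) = f r := by
  change evalLinear f c (Polynomial.monomial 0 r) = f r
  rw [evalLinear_monomial, pow_zero, mul_one]

@[simp]
theorem lift_var (f : R →ₐ[k] C) (c : C)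
    (h : ∀ r, c * f r = f (d.σ r) * c + f (d.δ r)) : lift f c h (var d) = c := by
  change evalLinear f c (Polynomial.monomial 1 1) = c
  rw [evalLinear_monomial, pow_one, map_one, one_mul]

theorem ofPoly_monomial (n : ℕ) (r : R) :
    ofPoly d (Polynomial.monomial n r) = const d r * var d ^ n := by
  have h : var d ^ n = ofPoly d (Polynomial.monomial n 1) := by
    induction n with
    | zero => rfl
    | succ n ih =>
      have h1 : d.δ 1 = 0 := by simpa using d.leibniz 1 1
      rw [pow_succ', ih, var, ← ofPoly_mulLeft, mulLeft_monomial]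
      simp [shift_monomial, h1]
  rw [h, ← ofPoly_C, ← ofPoly_mulLeft, mulLeft_C, constMul_apply, Polynomial.C_mul_monomial,
    mul_one]

theorem semiconjBy_of_generators {f g : OreExtension d →ₐ[k] C} {c : C}
    (h : ∀ r, SemiconjBy c (f (const d r)) (g (const d r)))
    (hv : SemiconjBy c (f (var d)) (g (var d))) (p : OreExtension d) :
    SemiconjBy c (f p) (g p) := by
  have hl : LinearMap.mulLeft k c ∘ₗ f.toLinearMap ∘ₗ (ofPoly d).toLinearMap =
      LinearMap.mulRight k c ∘ₗ g.toLinearMap ∘ₗ (ofPoly d).toLinearMap :=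
    linearMap_ext fun n r => by
      simpa [ofPoly_monomial] using ((h r).mul_right (hv.pow_right n)).eq
  exact LinearMap.congr_fun hl p

theorem coeff_shift_pow {p : Polynomial R} {n : ℕ} (hp : p.natDegree ≤ n) (i : ℕ) :
    ((shift d ^ i) p).coeff (n + i) = d.σ^[i] (p.coeff n) ∧
      ∀ m, n + i < m → ((shift d ^ i) p).coeff m = 0 := by
  induction i with
  | zero =>
    exact ⟨rfl, fun m hm => Polynomial.coeff_eq_zero_of_natDegree_lt (hp.trans_lt hm)⟩
  | succ i ih =>
    obtain ⟨ih1, ih2⟩ := ih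
    rw [pow_succ', Module.End.mul_apply]
    refine ⟨?_, fun m hm => ?_⟩
    · rw [← add_assoc, coeff_shift, ih1, ih2 _ (Nat.lt_succ_self _), map_zero, add_zero,
        Function.iterate_succ_apply']
    · obtain ⟨m, rfl⟩ : ∃ m', m = m' + 1 := ⟨m - 1, by omega⟩
      rw [coeff_shift, ih2 m (by omega), ih2 (m + 1) (by omega), map_zero, map_zero, add_zero]

theorem coeff_mulLeft (p q : Polynomial R) :
    (mulLeft d p q).coeff (q.natDegree + p.natDegree) =
      p.leadingCoeff * d.σ^[p.natDegree] q.leadingCoeff := by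
  have hs : mulLeft d p q =
      ∑ i ∈ Finset.range (p.natDegree + 1), Polynomial.C (p.coeff i) * (shift d ^ i) q := by
    conv_lhs => rw [p.as_sum_range, map_sum, LinearMap.sum_apply]
    refine Finset.sum_congr rfl fun i _ => ?_
    rw [mulLeft_monomial]
    rfl
  rw [hs, Polynomial.finsetSum_coeff, Finset.sum_range_succ, Finset.sum_eq_zero, zero_add,
    Polynomial.coeff_C_mul, (coeff_shift_pow le_rfl _).1]
  · rfl
  · intro i hi
    rw [Polynomial.coeff_C_mul, (coeff_shift_pow le_rfl i).2, mul_zero]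
    simpa using hi

theorem noZeroDivisors [NoZeroDivisors R] (hσ : Function.Injective d.σ) :
    NoZeroDivisors (OreExtension d) where
  eq_zero_or_eq_zero_of_mul_eq_zero := by
    intro p q hpq
    by_contra! hne
    have hc := coeff_mulLeft (d := d) ((ofPoly d).symm p) ((ofPoly d).symm q)
    have hz : mulLeft d ((ofPoly d).symm p) ((ofPoly d).symm q) = 0 := hpq
    rw [hz, Polynomial.coeff_zero, eq_comm, mul_eq_zero, Polynomial.leadingCoeff_eq_zero] at hc
    rcases hc with hc | hc
    · exact hne.1 hc
    · have h0 : d.σ^[((ofPoly d).symm p).natDegree] 0 = 0 := iterate_map_zero d.σ _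
      exact hne.2 (Polynomial.leadingCoeff_eq_zero.1 ((hσ.iterate _) (hc.trans h0.symm)))

end OreExtension

namespace MvPolynomial

variable {k ι C : Type*} [CommRing k] [Ring C] [Algebra k C]

open scoped IsMulCommutative in
theorem exists_algHom_of_commute (c : ι → C) (hc : ∀ i j, c i * c j = c j * c i) :
    ∃ f : MvPolynomial ι k →ₐ[k] C, ∀ i, f (X i) = c i := by
  have hs : ∀ a ∈ Set.range c, ∀ b ∈ Set.range c, a * b = b * a := by
    rintro _ ⟨i, rfl⟩ _ ⟨j, rfl⟩
    exact hc i j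
  have := Algebra.isMulCommutative_adjoin k hs
  let e : MvPolynomial ι k →ₐ[k] Algebra.adjoin k (Set.range c) :=
    aeval fun i => ⟨c i, Algebra.subset_adjoin ⟨i, rfl⟩⟩
  exact ⟨(Algebra.adjoin k (Set.range c)).val.comp e, fun i => by simp [e]⟩

theorem semiconjBy_of_generators {f g : MvPolynomial ι k →ₐ[k] C} {c : C}
    (h : ∀ i, SemiconjBy c (f (X i)) (g (X i))) (p : MvPolynomial ι k) :
    SemiconjBy c (f p) (g p) := by
  induction p using induction_on with
  | C a =>
    rw [algHom_C, algHom_C]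
    exact (Algebra.commutes a c).symm
  | add p q hp hq =>
    rw [map_add, map_add]
    exact hp.add_right hq
  | mul_X p i hp =>
    rw [map_mul, map_mul]
    exact hp.mul_right (h i)

theorem mul_eq_mul_add_of_generators {D : Derivation k (MvPolynomial ι k) (MvPolynomial ι k)}
    {f : MvPolynomial ι k →ₐ[k] C} {c : C}
    (h : ∀ i, c * f (X i) = f (X i) * c + f (D (X i))) (p : MvPolynomial ι k) :
    c * f p = f p * c + f (D p) := by
  induction p using induction_on with
  | C a =>
    rw [algHom_C, derivation_C, map_zero, add_zero]
    exact (Algebra.commutes a c).symm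
  | add p q hp hq => simp only [map_add, mul_add, add_mul, hp, hq]; abel
  | mul_X p i hp =>
    have e : D (p * X i) = p * D (X i) + D p * X i := by
      rw [D.leibniz, smul_eq_mul, smul_eq_mul, mul_comm (D p)]
    rw [map_mul, ← mul_assoc, hp, add_mul, mul_assoc, h i, e, map_add, map_mul, map_mul]
    noncomm_ring

end MvPolynomial

namespace Lstr

section Model

variable (k : Type*) [Field k] (G : ℕ)

/-- The commutative coefficient ring `k[x₁, y₀, …, y_G]`. -/
abbrev Coeff : Type _ := MvPolynomial (Option (Fin (G + 1))) k

/-- The variable `x₁`. -/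
noncomputable def coeffX : Coeff k G := MvPolynomial.X none

/-- The variable `y_t`, extended by zero for `t > G`. -/
noncomputable def coeffY (t : ℕ) : Coeff k G :=
  if h : t < G + 1 then MvPolynomial.X (some ⟨t, h⟩) else 0

/-- The derivation with `x₁ ↦ -x₁² / 2` and `y_t ↦ y_{t+1}`. -/
noncomputable def coeffDer : Derivation k (Coeff k G) (Coeff k G) :=
  MvPolynomial.mkDerivation k fun i =>
    i.elim (-((2 : k)⁻¹ • (coeffX k G * coeffX k G))) fun t => coeffY k G (t + 1)

theorem coeffY_fin (t : Fin (G + 1)) : coeffY k G t = MvPolynomial.X (some t) := by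
  rw [coeffY, dif_pos t.isLt]

theorem coeffDer_X :
    coeffDer k G (coeffX k G) = -((2 : k)⁻¹ • (coeffX k G * coeffX k G)) :=
  MvPolynomial.mkDerivation_X _ _ _

theorem coeffDer_Y (t : ℕ) : coeffDer k G (coeffY k G t) = coeffY k G (t + 1) := by
  by_cases h : t < G + 1
  · rw [coeffY, dif_pos h, coeffDer, MvPolynomial.mkDerivation_X]
    rfl
  · rw [coeffY, dif_neg h, map_zero, coeffY, dif_neg (by omega)]

variable {k G} in
theorem forall_generator {p : Coeff k G → Prop} (hx : p (coeffX k G))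
    (hy : ∀ t, p (coeffY k G t)) (i : Option (Fin (G + 1))) : p (MvPolynomial.X i) := by
  cases i with
  | none => exact hx
  | some t => exact coeffY_fin k G t ▸ hy t

variable {k} in
/-- The grading automorphism `x₁ ↦ a x₁`, `y_t ↦ aᵗ y_t`. -/
noncomputable def coeffScale (a : k) : Coeff k G →ₐ[k] Coeff k G :=
  MvPolynomial.aeval fun i => i.elim (a • coeffX k G) fun t => a ^ (t : ℕ) • coeffY k G t

theorem coeffScale_X (a : k) : coeffScale G a (coeffX k G) = a • coeffX k G :=
  MvPolynomial.aeval_X _ _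

theorem coeffScale_Y (a : k) (t : ℕ) :
    coeffScale G a (coeffY k G t) = a ^ t • coeffY k G t := by
  by_cases h : t < G + 1
  · conv_lhs => rw [coeffY, dif_pos h, coeffScale, MvPolynomial.aeval_X]
    rfl
  · rw [coeffY, dif_neg h, map_zero, smul_zero]

/-- The derivation `coeffDer` as a skew derivation. -/
noncomputable def untwistedDer : SkewDerivation k (Coeff k G) where
  σ := AlgHom.id k _
  δ := coeffDer k G
  leibniz a b := by simp [mul_comm b]

/-- The algebra obtained from `B(lstr(1,G))` at `q = 1`, as an Ore extension. -/
abbrev Untwisted : Type _ := OreExtension (untwistedDer k G)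

/-- The generator `x₁` of `Untwisted`. -/
noncomputable def untwistedX₁ : Untwisted k G := OreExtension.const _ (coeffX k G)

/-- The generator `x₂` of `Untwisted`. -/
noncomputable def untwistedX₂ : Untwisted k G := OreExtension.var _

/-- The elements `y_t` of `Untwisted`. -/
noncomputable def untwistedY (t : ℕ) : Untwisted k G := OreExtension.const _ (coeffY k G t)

theorem untwistedX₂_mul_X₁ :
    untwistedX₂ k G * untwistedX₁ k G = untwistedX₁ k G * untwistedX₂ k G -
      (2 : k)⁻¹ • (untwistedX₁ k G * untwistedX₁ k G) := by
  rw [untwistedX₂, untwistedX₁, OreExtension.var_mul_const]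
  change _ + OreExtension.const _ (coeffDer k G (coeffX k G)) = _
  rw [coeffDer_X, map_neg, map_smul, map_mul, sub_eq_add_neg]
  rfl

theorem untwistedX₂_mul_Y (t : ℕ) :
    untwistedX₂ k G * untwistedY k G t = untwistedY k G t * untwistedX₂ k G +
      untwistedY k G (t + 1) := by
  rw [untwistedX₂, untwistedY, OreExtension.var_mul_const]
  change _ + OreExtension.const _ (coeffDer k G (coeffY k G t)) = _
  rw [coeffDer_Y]
  rfl

theorem untwistedY_commute (s t : ℕ) :
    untwistedY k G s * untwistedY k G t = untwistedY k G t * untwistedY k G s := by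
  simp only [untwistedY, ← map_mul, mul_comm]

theorem untwistedX₁_mul_Y (t : ℕ) :
    untwistedX₁ k G * untwistedY k G t = untwistedY k G t * untwistedX₁ k G := by
  simp only [untwistedX₁, untwistedY, ← map_mul, mul_comm]

variable {k} in
/-- The grading automorphism of `Untwisted`. -/
noncomputable def untwistedScale (a : k) : Untwisted k G →ₐ[k] Untwisted k G :=
  OreExtension.lift ((OreExtension.const _).comp (coeffScale G a)) (a • untwistedX₂ k G)
    (MvPolynomial.mul_eq_mul_add_of_generators (D := coeffDer k G) (forall_generator
      (p := fun r => a • untwistedX₂ k G * OreExtension.const _ (coeffScale G a r) =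
        OreExtension.const _ (coeffScale G a r) * a • untwistedX₂ k G +
          OreExtension.const _ (coeffScale G a (coeffDer k G r)))
      (by
        have h := untwistedX₂_mul_X₁ k G
        rw [untwistedX₁] at h
        simp [coeffScale_X, coeffDer_X, h, smul_smul, sub_eq_add_neg]
        ring_nf)
      (fun t => by
        have h := untwistedX₂_mul_Y k G t
        rw [untwistedY, untwistedY] at h
        simp [coeffScale_Y, coeffDer_Y, h, smul_smul, pow_succ, mul_comm])))

theorem untwistedScale_X₁ (a : k) :
    untwistedScale G a (untwistedX₁ k G) = a • untwistedX₁ k G := by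
  rw [untwistedX₁, untwistedScale]
  exact (OreExtension.lift_const _ _ _ _).trans (by simp [coeffScale_X])

theorem untwistedScale_X₂ (a : k) :
    untwistedScale G a (untwistedX₂ k G) = a • untwistedX₂ k G := by
  rw [untwistedScale]
  exact OreExtension.lift_var _ _ _

theorem untwistedScale_Y (a : k) (t : ℕ) :
    untwistedScale G a (untwistedY k G t) = a ^ t • untwistedY k G t := by
  rw [untwistedY, untwistedScale]
  exact (OreExtension.lift_const _ _ _ _).trans (by simp [coeffScale_Y])

variable {k G} in
theorem untwisted_semiconjBy {C : Type*} [Ring C] [Algebra k C] {f g : Untwisted k G →ₐ[k] C}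
    {c : C} (h₁ : SemiconjBy c (f (untwistedX₁ k G)) (g (untwistedX₁ k G)))
    (h₂ : SemiconjBy c (f (untwistedX₂ k G)) (g (untwistedX₂ k G)))
    (hy : ∀ t, SemiconjBy c (f (untwistedY k G t)) (g (untwistedY k G t)))
    (p : Untwisted k G) : SemiconjBy c (f p) (g p) :=
  OreExtension.semiconjBy_of_generators (MvPolynomial.semiconjBy_of_generators
    (f := f.comp (OreExtension.const _)) (g := g.comp (OreExtension.const _))
    (forall_generator (p := fun r => SemiconjBy c (f (OreExtension.const _ r))
      (g (OreExtension.const _ r))) h₁ hy)) h₂ p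

theorem untwistedScale_injective {a : k} (ha : a ≠ 0) :
    Function.Injective (untwistedScale G a) := by
  refine Function.LeftInverse.injective (g := untwistedScale G a⁻¹) fun p => ?_
  have h := untwisted_semiconjBy (c := 1)
    (f := (untwistedScale G a⁻¹).comp (untwistedScale G a)) (g := AlgHom.id k _)
    (by simp [untwistedScale_X₁, smul_smul, ha]) (by simp [untwistedScale_X₂, smul_smul, ha])
    (fun t => by simp [untwistedScale_Y, smul_smul, ha]) p
  simpa [SemiconjBy] using h

instance : NoZeroDivisors (Untwisted k G) :=
  OreExtension.noZeroDivisors Function.injective_id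

variable {k} in
/-- The grading automorphism of `Untwisted` as a skew derivation with zero derivation part. -/
noncomputable def scaleDer (a : k) : SkewDerivation k (Untwisted k G) where
  σ := untwistedScale G a
  δ := 0
  leibniz := by simp

end Model

section Quotient

variable {k : Type*} [Field k] (q : k) (G : ℕ)

/-- The algebra `B(lstr(1,G))`. -/
abbrev Alg : Type _ := RingQuot (lstrRel k q G)

/-- The generators of `B(lstr(1,G))`. -/
noncomputable def gen (i : Fin 3) : Alg q G := RingQuot.mkAlgHom k (lstrRel k q G) (X k i)

/-- The elements `z_t` of `B(lstr(1,G))`. -/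
noncomputable def algZ (t : ℕ) : Alg q G := RingQuot.mkAlgHom k (lstrRel k q G) (z k q t)

variable {q G}

theorem mk_eq_zero {a : FreeAlgebra k (Fin 3)} (h : lstrRel k q G a 0) :
    RingQuot.mkAlgHom k (lstrRel k q G) a = 0 := by
  rw [RingQuot.mkAlgHom_rel k h, map_zero]

theorem algZ_zero : algZ q G 0 = gen q G 2 := rfl

theorem algZ_succ (t : ℕ) :
    algZ q G (t + 1) = gen q G 1 * algZ q G t - q • (algZ q G t * gen q G 1) := by
  simp [algZ, gen, z]

theorem gen_one_mul_algZ (t : ℕ) :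
    gen q G 1 * algZ q G t = q • (algZ q G t * gen q G 1) + algZ q G (t + 1) := by
  rw [algZ_succ]
  abel

theorem gen_one_mul_gen_zero : gen q G 1 * gen q G 0 =
    gen q G 0 * gen q G 1 - (2 : k)⁻¹ • (gen q G 0 * gen q G 0) := by
  have h := mk_eq_zero (q := q) (G := G) ⟨rfl, Or.inl rfl⟩
  simp only [map_add, map_sub, map_mul, map_smul] at h
  rw [← sub_eq_zero, ← h]
  simp only [gen]
  abel

theorem gen_zero_mul_algZ (t : ℕ) :
    gen q G 0 * algZ q G t = q • (algZ q G t * gen q G 0) := by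
  induction t with
  | zero =>
    have h := mk_eq_zero (q := q) (G := G) ⟨rfl, Or.inr (Or.inl rfl)⟩
    simpa [sub_eq_zero, gen, algZ, z] using h
  | succ t ih =>
    have h₀ : gen q G 0 * gen q G 1 =
        gen q G 1 * gen q G 0 + (2 : k)⁻¹ • (gen q G 0 * gen q G 0) := by
      rw [gen_one_mul_gen_zero]
      abel
    have h₁ : gen q G 0 * (gen q G 1 * algZ q G t) = q • (gen q G 1 * (algZ q G t * gen q G 0)) +
        (2 : k)⁻¹ • (q * q) • (algZ q G t * (gen q G 0 * gen q G 0)) := by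
      rw [← mul_assoc, h₀, add_mul, mul_assoc, ih, smul_mul_assoc, mul_assoc (gen q G 0), ih]
      simp only [mul_smul_comm, ← mul_assoc, ih, smul_mul_assoc, smul_smul]
    have h₂ : gen q G 0 * (algZ q G t * gen q G 1) = q • (algZ q G t * (gen q G 1 * gen q G 0)) +
        q • (2 : k)⁻¹ • (algZ q G t * (gen q G 0 * gen q G 0)) := by
      rw [← mul_assoc, ih, smul_mul_assoc, mul_assoc, h₀]
      simp only [mul_add, mul_smul_comm, smul_add]
    rw [algZ_succ, mul_sub, mul_smul_comm, h₁, h₂]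
    simp only [sub_mul, smul_mul_assoc, smul_sub, smul_add, smul_smul, mul_assoc,
      mul_comm (2 : k)⁻¹]
    abel

theorem algZ_eq_zero {t : ℕ} (ht : G < t) : algZ q G t = 0 := by
  induction t, ht using Nat.le_induction with
  | base => exact mk_eq_zero ⟨rfl, Or.inr (Or.inr (Or.inl rfl))⟩
  | succ t _ ih => rw [algZ_succ, ih, mul_zero, zero_mul, smul_zero, sub_zero]

theorem algZ_mul_algZ_add (hq : q ≠ 0) (d : ℕ) : ∀ i,
    q ^ d • (algZ q G i * algZ q G (i + d)) = algZ q G (i + d) * algZ q G i := by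
  induction d using Nat.twoStepInduction with
  | zero => simp
  | one =>
    intro i
    by_cases hi : i < G
    · have h := mk_eq_zero (q := q) (G := G) ⟨rfl, Or.inr (Or.inr (Or.inr ⟨i, hi, rfl⟩))⟩
      simp only [map_sub, map_mul, map_smul, sub_eq_zero] at h
      change algZ q G i * algZ q G (i + 1) = _ at h
      rw [h, pow_one, smul_inv_smul₀ hq]
      rfl
    · rw [algZ_eq_zero (t := i + 1) (by omega), mul_zero, zero_mul, smul_zero]
  | more d ih₁ ih₂ =>
    intro i
    have h₁ := ih₁ (i + 1)
    have h₂ := ih₂ i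
    rw [show i + 1 + d = i + (d + 1) by omega] at h₁
    have e₁ : gen q G 1 * (algZ q G i * algZ q G (i + (d + 1))) =
        (q * q) • (algZ q G i * algZ q G (i + (d + 1)) * gen q G 1) +
        q • (algZ q G i * algZ q G (i + (d + 2))) +
        algZ q G (i + 1) * algZ q G (i + (d + 1)) := by
      rw [← mul_assoc, gen_one_mul_algZ, add_mul, smul_mul_assoc, mul_assoc, gen_one_mul_algZ]
      simp only [mul_add, mul_smul_comm, smul_add, smul_smul, mul_assoc]
      rfl
    have e₂ : gen q G 1 * (algZ q G (i + (d + 1)) * algZ q G i) =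
        (q * q) • (algZ q G (i + (d + 1)) * algZ q G i * gen q G 1) +
        q • (algZ q G (i + (d + 1)) * algZ q G (i + 1)) +
        algZ q G (i + (d + 2)) * algZ q G i := by
      rw [← mul_assoc, gen_one_mul_algZ, add_mul, smul_mul_assoc, mul_assoc, gen_one_mul_algZ]
      simp only [mul_add, mul_smul_comm, smul_add, smul_smul, mul_assoc]
      rfl
    rw [← h₂, ← h₁, mul_smul_comm, e₁] at e₂
    simp only [smul_add, smul_smul, smul_mul_assoc] at e₂
    rw [show q ^ (d + 1) * (q * q) = q * q * q ^ (d + 1) by ring,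
      show q ^ (d + 1) = q * q ^ d by ring, add_assoc, add_assoc] at e₂
    have e₃ := add_left_cancel e₂
    rw [add_comm] at e₃
    have e₄ := add_left_cancel e₃
    rw [← e₄]
    congr 1
    ring

theorem algZ_mul_algZ (hq : q ≠ 0) (i j : ℕ) :
    q ^ j • (algZ q G i * algZ q G j) = q ^ i • (algZ q G j * algZ q G i) := by
  wlog hij : i ≤ j generalizing i j
  · exact (this j i (by omega)).symm
  obtain ⟨d, rfl⟩ := Nat.exists_eq_add_of_le hij
  rw [← algZ_mul_algZ_add hq, smul_smul, pow_add]

/-- An algebra homomorphism out of `B(lstr(1,G))` is given by images of the generators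
satisfying the defining relations. -/
theorem exists_algHom {C : Type*} [Ring C] [Algebra k C] (x₁ x₂ : C) (w : ℕ → C)
    (hw : ∀ t, w (t + 1) = x₂ * w t - q • (w t * x₂))
    (h₁ : x₂ * x₁ = x₁ * x₂ - (2 : k)⁻¹ • (x₁ * x₁))
    (h₂ : x₁ * w 0 = q • (w 0 * x₁)) (h₃ : w (G + 1) = 0)
    (h₄ : ∀ t < G, w t * w (t + 1) = q⁻¹ • (w (t + 1) * w t)) :
    ∃ f : Alg q G →ₐ[k] C, f (gen q G 0) = x₁ ∧ f (gen q G 1) = x₂ ∧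
      ∀ t, f (algZ q G t) = w t := by
  let g : FreeAlgebra k (Fin 3) →ₐ[k] C := FreeAlgebra.lift k ![x₁, x₂, w 0]
  have g₀ : g (X k 0) = x₁ := by simp [g, X]
  have g₁ : g (X k 1) = x₂ := by simp [g, X]
  have g₂ : g (X k 2) = w 0 := by simp [g, X]
  have gz : ∀ t, g (z k q t) = w t := by
    intro t
    induction t with
    | zero => exact g₂
    | succ t ih => rw [z, map_sub, map_smul, map_mul, map_mul, ih, g₁, hw]
  have hg : ∀ ⦃a b⦄, lstrRel k q G a b → g a = g b := by
    rintro a b ⟨rfl, rfl | rfl | rfl | ⟨t, ht, rfl⟩⟩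
    · simp [g₀, g₁, h₁]
    · simp [g₀, g₂, h₂]
    · simp [gz, h₃]
    · simp [gz, h₄ t ht]
  refine ⟨RingQuot.liftAlgHom k ⟨g, hg⟩, ?_, ?_, fun t => ?_⟩
  · rw [gen, RingQuot.liftAlgHom_mkAlgHom_apply, g₀]
  · rw [gen, RingQuot.liftAlgHom_mkAlgHom_apply, g₁]
  · rw [algZ, RingQuot.liftAlgHom_mkAlgHom_apply, gz]

theorem alg_hom_ext {C : Type*} [Ring C] [Algebra k C] {f g : Alg q G →ₐ[k] C}
    (h : ∀ i, f (gen q G i) = g (gen q G i)) : f = g :=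
  RingQuot.ringQuot_ext' k _ _ (FreeAlgebra.hom_ext (funext h))

theorem exists_scale (hq : q ≠ 0) (a : k) :
    ∃ f : Alg q G →ₐ[k] Alg q G, f (gen q G 0) = a • gen q G 0 ∧
      f (gen q G 1) = a • gen q G 1 ∧ ∀ t, f (algZ q G t) = a ^ t • algZ q G t := by
  refine exists_algHom _ _ (fun t => a ^ t • algZ q G t) (fun t => ?_) ?_ ?_ ?_ (fun t _ => ?_)
  · simp only [algZ_succ, smul_sub, smul_mul_smul_comm, smul_smul]
    congr 2 <;> ring
  · simp only [smul_mul_smul_comm, gen_one_mul_gen_zero, smul_sub, smul_smul]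
    congr 2
    ring
  · simp only [smul_mul_smul_comm, gen_zero_mul_algZ, smul_smul]
    congr 1
    ring
  · simp [algZ_eq_zero (Nat.lt_succ_self G)]
  · have h := algZ_mul_algZ_add (G := G) hq 1 t
    simp only [smul_mul_smul_comm, ← h, smul_smul]
    congr 1
    field_simp

end Quotient

section Embedding

variable {k : Type*} [Field k] {q : k} {G : ℕ}

variable (q G) in
/-- The twisted model: the Ore extension of `Untwisted` by the grading automorphism. -/
abbrev Model : Type _ := OreExtension (scaleDer G q⁻¹)

theorem exists_modelHom (hq : q ≠ 0) :
    ∃ f : Alg q G →ₐ[k] Model q G, f (gen q G 0) = OreExtension.const _ (untwistedX₁ k G) ∧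
      f (gen q G 1) = OreExtension.const _ (untwistedX₂ k G) ∧
      f (gen q G 2) = OreExtension.const _ (untwistedY k G 0) * OreExtension.var _ := by
  let v : Model q G := OreExtension.var _
  let c : Untwisted k G →ₐ[k] Model q G := OreExtension.const _
  have hv : ∀ p, v * c p = c (untwistedScale G q⁻¹ p) * v := fun p =>
    (OreExtension.var_mul_const _ p).trans (by
      change _ + c 0 = _
      rw [map_zero, add_zero]
      rfl)
  have hx₁ : v * c (untwistedX₁ k G) = q⁻¹ • (c (untwistedX₁ k G) * v) := by
    rw [hv, untwistedScale_X₁, map_smul, smul_mul_assoc]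
  have hx₂ : v * c (untwistedX₂ k G) = q⁻¹ • (c (untwistedX₂ k G) * v) := by
    rw [hv, untwistedScale_X₂, map_smul, smul_mul_assoc]
  have hy : ∀ t, v * c (untwistedY k G t) = q⁻¹ ^ t • (c (untwistedY k G t) * v) := fun t => by
    rw [hv, untwistedScale_Y, map_smul, smul_mul_assoc]
  refine (exists_algHom (q := q) (G := G) (c (untwistedX₁ k G)) (c (untwistedX₂ k G))
    (fun t => c (untwistedY k G t) * v) (fun t => ?_) ?_ ?_ ?_ (fun t _ => ?_)).imp
    fun f hf => ⟨hf.1, hf.2.1, hf.2.2 0⟩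
  · rw [mul_assoc, hx₂, mul_smul_comm, smul_inv_smul₀ hq, ← mul_assoc, ← mul_assoc, ← map_mul,
      ← map_mul, untwistedX₂_mul_Y, map_add, add_mul, add_sub_cancel_left]
  · simp only [← map_mul, untwistedX₂_mul_X₁, map_sub, map_smul]
  · rw [mul_assoc, hx₁, mul_smul_comm, smul_inv_smul₀ hq, ← mul_assoc, ← mul_assoc, ← map_mul,
      ← map_mul, untwistedX₁_mul_Y]
  · simp [untwistedY, coeffY]
  · have e : ∀ i j, c (untwistedY k G i) * v * (c (untwistedY k G j) * v) =
        q⁻¹ ^ j • (c (untwistedY k G i * untwistedY k G j) * (v * v)) := fun i j => by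
      rw [mul_assoc, ← mul_assoc v, hy, map_mul]
      simp only [smul_mul_assoc, mul_smul_comm, mul_assoc]
    rw [e, e, untwistedY_commute, smul_smul, pow_succ']

theorem exists_hom_toEnd (hq : q ≠ 0) :
    ∃ f : Model q G →ₐ[k] Module.End k (Alg q G),
      f (OreExtension.const _ (untwistedX₁ k G)) = Algebra.lmul k _ (gen q G 0) ∧
      f (OreExtension.const _ (untwistedX₂ k G)) = Algebra.lmul k _ (gen q G 1) ∧
      f (OreExtension.const _ (untwistedY k G 0) * OreExtension.var _) =
        Algebra.lmul k _ (gen q G 2) := by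
  choose F hF₀ hF₁ hFz using fun a : k => exists_scale (G := G) hq a
  let L : Alg q G →ₐ[k] Module.End k (Alg q G) := Algebra.lmul k _
  let S : k → Module.End k (Alg q G) := fun a => (F a).toLinearMap
  have hSL : ∀ a p, S a * L p = L (F a p) * S a := fun a p => by
    ext r
    simp [S, L]
  have hS₀ : ∀ a, S a * L (gen q G 0) = a • (L (gen q G 0) * S a) := fun a => by
    rw [hSL, hF₀, map_smul, smul_mul_assoc]
  have hS₁ : ∀ a, S a * L (gen q G 1) = a • (L (gen q G 1) * S a) := fun a => by
    rw [hSL, hF₁, map_smul, smul_mul_assoc]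
  have hSz : ∀ a t, S a * L (algZ q G t) = a ^ t • (L (algZ q G t) * S a) := fun a t => by
    rw [hSL, hFz, map_smul, smul_mul_assoc]
  have hSS : ∀ a b, a * b = 1 → S a * S b = 1 := fun a b hab => by
    have h : (F a).comp (F b) = AlgHom.id k _ := alg_hom_ext fun i => by
      fin_cases i
      · simp [hF₀, smul_smul, mul_comm b, hab]
      · simp [hF₁, smul_smul, mul_comm b, hab]
      · simp [← algZ_zero, hFz]
    ext p
    exact AlgHom.congr_fun h p
  let Y : ℕ → Module.End k (Alg q G) := fun t => L (algZ q G t) * S q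
  have hYY : ∀ i j, Y i * Y j = Y j * Y i := fun i j => by
    have e : ∀ i j, Y i * Y j = L (q ^ j • (algZ q G i * algZ q G j)) * (S q * S q) :=
      fun i j => by
        simp only [Y]
        rw [mul_assoc, ← mul_assoc (S q), hSz, map_smul, map_mul]
        simp only [smul_mul_assoc, mul_smul_comm, mul_assoc]
    rw [e, e, algZ_mul_algZ hq]
  have hXY : ∀ t, L (gen q G 0) * Y t = Y t * L (gen q G 0) := fun t => by
    simp only [Y]
    rw [mul_assoc, hS₀, mul_smul_comm, ← mul_assoc, ← mul_assoc, ← map_mul, ← map_mul,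
      gen_zero_mul_algZ, map_smul, smul_mul_assoc]
  have hX₂Y : ∀ t, L (gen q G 1) * Y t = Y t * L (gen q G 1) + Y (t + 1) := fun t => by
    simp only [Y]
    rw [mul_assoc, hS₁, mul_smul_comm, ← mul_assoc, ← mul_assoc, ← map_mul, ← map_mul,
      gen_one_mul_algZ, map_add, add_mul, map_smul, smul_mul_assoc]
  obtain ⟨f, hf⟩ := MvPolynomial.exists_algHom_of_commute (k := k)
    (fun i : Option (Fin (G + 1)) => i.elim (L (gen q G 0)) fun t => Y t) (by
      rintro (_ | i) (_ | j)
      · rfl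
      · exact hXY j
      · exact (hXY i).symm
      · exact hYY i j)
  have hfx : f (coeffX k G) = L (gen q G 0) := hf none
  have hfy : ∀ t, f (coeffY k G t) = Y t := fun t => by
    by_cases h : t < G + 1
    · rw [coeffY, dif_pos h, hf]
      rfl
    · simp only [Y]
      rw [coeffY, dif_neg h, map_zero, algZ_eq_zero (by omega), map_zero, zero_mul]
  let g : Untwisted k G →ₐ[k] Module.End k (Alg q G) :=
    OreExtension.lift f (L (gen q G 1)) (MvPolynomial.mul_eq_mul_add_of_generators
      (D := coeffDer k G) (f := f) (c := L (gen q G 1)) (forall_generator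
        (p := fun r => L (gen q G 1) * f r = f r * L (gen q G 1) + f (coeffDer k G r))
        (by
          rw [coeffDer_X, map_neg, map_smul, map_mul, hfx, ← map_mul, gen_one_mul_gen_zero,
            map_sub, map_smul, map_mul, map_mul, sub_eq_add_neg])
        (fun t => by rw [coeffDer_Y, hfy, hfy, hX₂Y])))
  have hg₁ : g (untwistedX₁ k G) = L (gen q G 0) := (OreExtension.lift_const _ _ _ _).trans hfx
  have hg₂ : g (untwistedX₂ k G) = L (gen q G 1) := OreExtension.lift_var _ _ _
  have hgy : ∀ t, g (untwistedY k G t) = Y t := fun t =>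
    (OreExtension.lift_const _ _ _ _).trans (hfy t)
  have hgS : ∀ p, SemiconjBy (S q⁻¹) (g p) (g (untwistedScale G q⁻¹ p)) :=
    untwisted_semiconjBy (C := Module.End k (Alg q G)) (c := S q⁻¹) (f := g)
      (g := g.comp (untwistedScale G q⁻¹))
      (by simp [SemiconjBy, untwistedScale_X₁, hg₁, hS₀])
      (by simp [SemiconjBy, untwistedScale_X₂, hg₂, hS₁])
      (fun t => by
        simp only [SemiconjBy, AlgHom.comp_apply, untwistedScale_Y, map_smul, hgy, Y]
        rw [← mul_assoc, hSz, smul_mul_assoc, smul_mul_assoc, mul_assoc, mul_assoc,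
          hSS _ _ (inv_mul_cancel₀ hq), hSS _ _ (mul_inv_cancel₀ hq)])
  refine ⟨OreExtension.lift g (S q⁻¹) fun p => ?_, ?_, ?_, ?_⟩
  · change _ = g (untwistedScale G q⁻¹ p) * S q⁻¹ + g 0
    rw [map_zero, add_zero]
    exact hgS p
  · exact (OreExtension.lift_const _ _ _ _).trans hg₁
  · exact (OreExtension.lift_const _ _ _ _).trans hg₂
  · rw [map_mul, OreExtension.lift_const, OreExtension.lift_var, hgy, mul_assoc,
      hSS _ _ (mul_inv_cancel₀ hq), mul_one, algZ_zero]

theorem noZeroDivisors (hq : q ≠ 0) : NoZeroDivisors (Alg q G) := by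
  obtain ⟨φ, hφ₀, hφ₁, hφ₂⟩ := exists_modelHom (G := G) hq
  obtain ⟨ψ, hψ₀, hψ₁, hψ₂⟩ := exists_hom_toEnd (G := G) hq
  have h : ψ.comp φ = Algebra.lmul k (Alg q G) := by
    refine alg_hom_ext (C := Module.End k (Alg q G)) fun i => ?_
    fin_cases i
    · exact (congrArg ψ hφ₀).trans hψ₀
    · exact (congrArg ψ hφ₁).trans hψ₁
    · exact (congrArg ψ hφ₂).trans hψ₂
  have hinj : Function.Injective φ := by
    refine Function.Injective.of_comp (f := ψ) ?_
    rw [← AlgHom.coe_comp, h]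
    exact Algebra.lmul_injective
  have : NoZeroDivisors (Model q G) :=
    OreExtension.noZeroDivisors (untwistedScale_injective k G (inv_ne_zero hq))
  exact hinj.noZeroDivisors φ (map_zero φ) (map_mul φ)

end Embedding

end Lstr


/-- The algebra `B(lstr(1,G))` is a domain: it has no nonzero
zero divisors. -/
theorem statement9 (k : Type*) [Field k] [IsAlgClosed k] [CharZero k]
    (q : k) (hq : q ≠ 0) (G : ℕ) (hG : 1 ≤ G) :
    ∀ a b : RingQuot (lstrRel k q G), a * b = 0 → a = 0 ∨ b = 0 := by
  have := Lstr.noZeroDivisors (G := G) hq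
  exact fun _ _ => mul_eq_zero.1
end

section
/- Let k be a field of characteristic 0, q ∈ k^×, ε ∈ {1, −1}, and let B be an associative k-algebra with elements x_1, x_2, x_3 ∈ B. Set x_21 := x_2x_1 − ε·x_1x_2, z_0 := x_3 and z_{n+1} := x_2·z_n − ε^n·q·z_n·x_2 for n ≥ 0. Assume x_1x_3 = q·x_3x_1 holds in B, and assume either (a) ε = 1 and x_2x_1 − x_1x_2 + (1/2)x_1² = 0 in B, or (b) ε = −1 and x_1² = 0, x_2x_21 − x_21x_2 − x_1x_21 = 0 and x_21x_3 = q²·x_3x_21 in B. Then for all n ∈ ℕ: x_1·z_n = ε^n·q·z_n·x_1 and x_21·z_n = q²·z_n·x_21. -/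
/-- If `x₁` and `y` both `q`-commute with `z`, and `x₁x₂ = ε (x₂x₁ - y)`, then `x₁` commutes up to
the scalar `ε c` with the braided commutator of `x₂` and `z`. -/
theorem mul_braidedCommutator_eq_smul {k B : Type*} [Field k] [Ring B] [Algebra k B]
    {ε c : k} {x₁ x₂ y z : B} (h12 : x₁ * x₂ = ε • (x₂ * x₁ - y))
    (h1 : x₁ * z = c • (z * x₁)) (hy : y * z = (c ^ 2) • (z * y)) :
    x₁ * (x₂ * z - c • (z * x₂)) = (ε * c) • ((x₂ * z - c • (z * x₂)) * x₁) := by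
  have e1 : x₁ * (x₂ * z) = ε • (c • (x₂ * z * x₁) - c ^ 2 • (z * y)) := by
    rw [← mul_assoc, h12, smul_mul_assoc, sub_mul, hy, mul_assoc, h1, mul_smul_comm, mul_assoc]
  have e2 : x₁ * (z * x₂) = c • (ε • (z * x₂ * x₁ - z * y)) := by
    rw [← mul_assoc, h1, smul_mul_assoc, mul_assoc, h12, mul_smul_comm, mul_sub, mul_assoc]
  rw [mul_sub, mul_smul_comm, e1, e2, sub_mul, smul_mul_assoc]
  module

/-- If `yx₂ = x₂y - x₁y`, where `x₁` and `y` commute with `z` up to the scalars `c` and `d`, then `y`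
commutes up to the scalar `d` with the braided commutator of `x₂` and `z`. -/
theorem mul_braidedCommutator_eq_smul_of_mul_eq_sub {k B : Type*} [Field k] [Ring B] [Algebra k B]
    {c d : k} {x₁ x₂ y z : B} (hy2 : y * x₂ = x₂ * y - x₁ * y)
    (h1 : x₁ * z = c • (z * x₁)) (hy : y * z = d • (z * y)) :
    y * (x₂ * z - c • (z * x₂)) = d • ((x₂ * z - c • (z * x₂)) * y) := by
  have e1 : y * (x₂ * z) = d • (x₂ * z * y) - d • c • (z * x₁ * y) := by
    rw [← mul_assoc, hy2, sub_mul, mul_assoc, hy, mul_assoc, hy, mul_smul_comm, mul_smul_comm,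
      ← mul_assoc, ← mul_assoc, h1, smul_mul_assoc]
  have e2 : y * (z * x₂) = d • (z * x₂ * y - z * x₁ * y) := by
    rw [← mul_assoc, hy, smul_mul_assoc, mul_assoc, hy2, mul_sub, mul_assoc, mul_assoc]
  rw [mul_sub, mul_smul_comm, e1, e2, sub_mul, smul_mul_assoc]
  module

/-- If `x` commutes with `z` up to the scalar `q`, then every multiple of `x * x` commutes with `z`
up to the scalar `q ^ 2`. -/
theorem smul_mul_self_mul_eq_smul {k B : Type*} [Field k] [Ring B] [Algebra k B]
    {q : k} {x z : B} (a : k) (h : x * z = q • (z * x)) :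
    (a • (x * x)) * z = (q ^ 2) • (z * (a • (x * x))) := by
  rw [smul_mul_assoc, mul_assoc, h, mul_smul_comm, ← mul_assoc, h, smul_mul_assoc, mul_smul_comm,
    mul_assoc]
  module

/-- Commutation relations of `x₁` and `x₂₁` with the elements
`z_n = (ad_c x₂)ⁿ x₃` in any algebra satisfying the Jordan (ε = 1) or super Jordan (ε = −1)
relations together with `x₁x₃ = q x₃x₁` (and, for ε = −1, `x₂₁x₃ = q² x₃x₂₁`). -/
theorem statement18 (k : Type*) [Field k] [CharZero k]
    (q : k) (hq : q ≠ 0) (ε : k) (hε : ε = 1 ∨ ε = -1)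
    (B : Type*) [Ring B] [Algebra k B]
    (x₁ x₂ x₃ : B)
    (x₂₁ : B) (hx₂₁ : x₂₁ = x₂ * x₁ - ε • (x₁ * x₂))
    (z : ℕ → B) (hz0 : z 0 = x₃)
    (hzrec : ∀ n : ℕ, z (n + 1) = x₂ * z n - (ε ^ n * q) • (z n * x₂))
    (h13 : x₁ * x₃ = q • (x₃ * x₁))
    (hcase :
      (ε = 1 ∧ x₂ * x₁ - x₁ * x₂ + ((2 : k)⁻¹) • (x₁ * x₁) = 0) ∨
      (ε = -1 ∧ x₁ * x₁ = 0 ∧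
        x₂ * x₂₁ - x₂₁ * x₂ - x₁ * x₂₁ = 0 ∧
        x₂₁ * x₃ = (q ^ 2) • (x₃ * x₂₁))) :
    ∀ n : ℕ,
      x₁ * z n = (ε ^ n * q) • (z n * x₁) ∧
      x₂₁ * z n = (q ^ 2) • (z n * x₂₁) := by
  have h12 : x₁ * x₂ = ε • (x₂ * x₁ - x₂₁) := by
    rcases hε with rfl | rfl <;> rw [hx₂₁] <;> module
  have hsq (n : ℕ) : (ε ^ n * q) ^ 2 = q ^ 2 := by
    have : ε ^ 2 = 1 := by rcases hε with rfl | rfl <;> norm_num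
    rw [mul_pow, ← pow_mul, mul_comm n 2, pow_mul, this, one_pow, one_mul]
  have step (n : ℕ) (h1 : x₁ * z n = (ε ^ n * q) • (z n * x₁))
      (hy : x₂₁ * z n = (q ^ 2) • (z n * x₂₁)) :
      x₁ * z (n + 1) = (ε ^ (n + 1) * q) • (z (n + 1) * x₁) := by
    rw [hzrec, pow_succ', mul_assoc]
    exact mul_braidedCommutator_eq_smul h12 h1 (by rwa [hsq])
  have base : x₁ * z 0 = (ε ^ 0 * q) • (z 0 * x₁) := by rw [hz0, pow_zero, one_mul, h13]
  rcases hcase with ⟨rfl, h⟩ | ⟨rfl, -, h, h213⟩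
  · have hy : x₂₁ = (-(2 : k)⁻¹) • (x₁ * x₁) := by
      rw [hx₂₁, one_smul, neg_smul]
      exact eq_neg_of_add_eq_zero_left h
    have of_left (n : ℕ) (h1 : x₁ * z n = ((1 : k) ^ n * q) • (z n * x₁)) :
        x₂₁ * z n = (q ^ 2) • (z n * x₂₁) := by
      rw [one_pow, one_mul] at h1
      rw [hy]
      exact smul_mul_self_mul_eq_smul _ h1
    intro n
    induction n with
    | zero => exact ⟨base, of_left 0 base⟩
    | succ n ih =>
      have h1 := step n ih.1 ih.2
      exact ⟨h1, of_left _ h1⟩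
  · have hy2 : x₂₁ * x₂ = x₂ * x₂₁ - x₁ * x₂₁ := by
      rw [← sub_eq_zero, ← neg_eq_zero, ← h]
      abel
    intro n
    induction n with
    | zero => exact ⟨base, by rw [hz0, h213]⟩
    | succ n ih =>
      refine ⟨step n ih.1 ih.2, ?_⟩
      rw [hzrec]
      exact mul_braidedCommutator_eq_smul_of_mul_eq_sub hy2 ih.1 ih.2
end

section
/- Let k be a field, q ∈ k^×, ε, Q ∈ {1, −1}, and let B be an associative k-algebra with elements x_2, x_3 ∈ B. Set z_0 := x_3 and z_{n+1} := x_2·z_n − ε^n·q·z_n·x_2 for n ≥ 0, and let N ∈ ℕ. (i) Assume that z_t·z_{t+1} = q^{−1}·Q·z_{t+1}·z_t for all 0 ≤ t < N, and that z_t² = 0 for all 0 ≤ t ≤ N with ε^t·Q = −1. Then z_t·z_k = ε^{t·k}·q^{t−k}·Q·z_k·z_t for all 0 ≤ t < k ≤ N. (ii) If t ∈ ℕ satisfies ε^t·Q = −1 and z_t² = 0 in B, then z_t·z_{t+1} = q^{−1}·Q·z_{t+1}·z_t. -/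
section SkewDerivation

variable {k B : Type*} [Field k] [Ring B] [Algebra k B]

/-- Skew Leibniz rule for `a ↦ x * a - α • (a * x)`. -/
theorem skew_commutator_mul {x a b a' b' : B} {α β : k}
    (ha : a' = x * a - α • (a * x)) (hb : b' = x * b - β • (b * x)) :
    x * (a * b) - (α * β) • (a * b * x) = a' * b + α • (a * b') := by
  subst ha hb
  simp only [sub_mul, mul_sub, smul_mul_assoc, mul_smul_comm, smul_sub, smul_smul, mul_assoc]
  abel

theorem smul_mul_skew_commutator_eq {x a b a' b' : B} {α β c : k}
    (ha : a' = x * a - α • (a * x)) (hb : b' = x * b - β • (b * x))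
    (hab : a * b = c • (b * a)) (hab' : a' * b = (c * β) • (b * a')) :
    α • (a * b') = c • (b' * a) := by
  have h₁ := skew_commutator_mul ha hb
  have h₂ := skew_commutator_mul hb ha
  have h₃ : a' * b + α • (a * b') = c • (b' * a + β • (b * a')) := by
    rw [← h₁, ← h₂, hab]
    simp only [smul_sub, smul_smul, mul_smul_comm, smul_mul_assoc]
    congr 2
    ring
  rw [hab', smul_add, smul_smul, add_comm] at h₃
  exact add_right_cancel h₃

theorem mul_skew_commutator_of_mul_self_eq_zero {x a a' : B} {α : k}
    (ha : a' = x * a - α • (a * x)) (h : a * a = 0) : a' * a = -(α • (a * a')) := by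
  have h₁ := skew_commutator_mul ha ha
  simp only [h, mul_zero, zero_mul, smul_zero, sub_zero] at h₁
  exact eq_neg_of_add_eq_zero_left h₁.symm

theorem q_commute_of_consecutive {q ε Q : k} (hq : q ≠ 0) (hε : ε * ε = 1)
    (hQ : Q = 1 ∨ Q = -1) {x : B} {z : ℕ → B}
    (hz : ∀ n : ℕ, z (n + 1) = x * z n - (ε ^ n * q) • (z n * x)) {N : ℕ}
    (hcons : ∀ t < N, z t * z (t + 1) = (q⁻¹ * Q) • (z (t + 1) * z t))
    (hsq : ∀ t ≤ N, ε ^ t * Q = -1 → z t ^ 2 = 0) (d : ℕ) :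
    ∀ t, t + d ≤ N → z t * z (t + d) =
      (ε ^ (t * (t + d)) * q ^ t * q⁻¹ ^ (t + d) * Q) • (z (t + d) * z t) := by
  have hqt (t : ℕ) : q ^ t * q⁻¹ ^ t = 1 := by rw [← mul_pow, mul_inv_cancel₀ hq, one_pow]
  have hεt (t : ℕ) : ε ^ t * ε ^ t = 1 := by rw [← mul_pow, hε, one_pow]
  have hεe {m : ℕ} (hm : Even m) : ε ^ m = 1 := by
    obtain ⟨r, rfl⟩ := hm
    rw [pow_add, hεt]
  induction d using Nat.twoStepInduction with
  | zero =>
    intro t ht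
    have hpow : ε ^ (t * t) = ε ^ t := by
      rcases Nat.even_or_odd t with h | ⟨r, rfl⟩
      · rw [hεe h, hεe (h.mul_left t)]
      · rw [show (2 * r + 1) * (2 * r + 1) = (r * (2 * r + 1) + r * (2 * r + 1)) + (2 * r + 1) by
          ring, pow_add, hεe ⟨_, rfl⟩, one_mul]
    rw [add_zero, hpow, mul_assoc (ε ^ t), hqt, mul_one]
    have hcases : ε ^ t * Q = 1 ∨ ε ^ t * Q = -1 := by
      apply mul_self_eq_one_iff.mp
      rw [mul_mul_mul_comm, hεt, one_mul]
      exact mul_self_eq_one_iff.mpr hQ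
    rcases hcases with h | h
    · rw [h, one_smul]
    · rw [← pow_two, hsq t ht h, smul_zero]
  | one =>
    intro t ht
    rw [hcons t ht, hεe (Nat.even_mul_succ_self t), one_mul, pow_succ, ← mul_assoc, hqt, one_mul]
  | more d ih₀ ih₁ =>
    intro t ht
    have h₀ := ih₀ (t + 1) (by omega)
    have h₁ := ih₁ t (by omega)
    rw [show t + 1 + d = t + (d + 1) by ring] at h₀
    have key := smul_mul_skew_commutator_eq (hz t) (hz (t + (d + 1))) h₁ (by
      rw [h₀]
      congr 1
      ring)
    have hα : (ε ^ t * q⁻¹) * (ε ^ t * q) = 1 := by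
      rw [mul_mul_mul_comm, hεt, inv_mul_cancel₀ hq, one_mul]
    rw [show t + (d + 2) = t + (d + 1) + 1 by ring]
    rw [← one_smul k (z t * _), ← hα, mul_smul, key, smul_smul]
    congr 1
    ring

end SkewDerivation

/-- q-commutation relations among the elements `z_n = (ad_c x₂)ⁿ x₃` in any
algebra: (i) if consecutive `z`'s q-commute and the appropriate squares vanish up to level `N`,
then all pairs `z_t, z_k` with `t < k ≤ N` q-commute; (ii) if `ε^t Q = −1` and `z_t² = 0`, then
`z_t` and `z_{t+1}` q-commute. -/
theorem statement19 (k : Type*) [Field k]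
    (q : k) (hq : q ≠ 0) (ε Q : k) (hε : ε = 1 ∨ ε = -1) (hQ : Q = 1 ∨ Q = -1)
    (B : Type*) [Ring B] [Algebra k B]
    (x₂ x₃ : B)
    (z : ℕ → B) (hz0 : z 0 = x₃)
    (hzrec : ∀ n : ℕ, z (n + 1) = x₂ * z n - (ε ^ n * q) • (z n * x₂))
    (N : ℕ) :
    ((∀ t < N, z t * z (t + 1) = (q⁻¹ * Q) • (z (t + 1) * z t)) →
      (∀ t ≤ N, ε ^ t * Q = -1 → z t ^ 2 = 0) →
      ∀ t u : ℕ, t < u → u ≤ N →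
        z t * z u = (ε ^ (t * u) * q ^ t * (q⁻¹) ^ u * Q) • (z u * z t)) ∧
    (∀ t : ℕ, ε ^ t * Q = -1 → z t ^ 2 = 0 →
      z t * z (t + 1) = (q⁻¹ * Q) • (z (t + 1) * z t)) := by
  refine ⟨fun hcons hsq t u htu hu => ?_, fun t ht hsq => ?_⟩
  · obtain ⟨d, rfl⟩ := Nat.exists_eq_add_of_le htu.le
    exact q_commute_of_consecutive hq (mul_self_eq_one_iff.mpr hε) hQ hzrec hcons hsq d t hu
  · have hQQ : Q * Q = 1 := mul_self_eq_one_iff.mpr hQ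
    have hεt : ε ^ t = -Q := by linear_combination Q * ht - ε ^ t * hQQ
    rw [mul_skew_commutator_of_mul_self_eq_zero (hzrec t) (by rw [← pow_two, hsq]), ← neg_smul,
      smul_smul, hεt]
    have hc : q⁻¹ * Q * -(-Q * q) = 1 := by
      linear_combination Q * Q * inv_mul_cancel₀ hq + hQQ
    rw [hc, one_smul]
end
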